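/- Fix an integer n ≥ 1 and a constant C₁ > 0. There exist constants δ > 1 and c > 0, depending only on n and C₁, such that the following holds. Let B₁ = ∏_{i=1}^n (−a_i, a_i) and B₂ = ∏_{i=1}^n (−b_i, b_i) be boxes in ℝⁿ with B₁ ⊆ B₂, and suppose both that 1/a_i² − 1/b_i² ≤ C₁/(max_j b_j²) for every i, and that a_i ≥ b_i/δ for every i. Then for every open connected set U with B₁ ⊆ U ⊆ B₂ and every principal Dirichlet eigenfunction φ_U of U, one has φ_U(x) ≥ c·φ_{B₁}(x) for all x ∈ B₁, where φ_{B₁}(x) = ∏_{i=1}^n a_i^{−1/2} cos(π x_i/(2 a_i)). -/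

import Mathlib

open Real MeasureTheory

noncomputable def dirichletEigenvalue (n : ℕ) (U : Set (EuclideanSpace ℝ (Fin n))) : ℝ :=
  sInf {R : ℝ | ∃ f : EuclideanSpace ℝ (Fin n) → ℝ,
    ContDiff ℝ (⊤ : ℕ∞) f ∧ HasCompactSupport f ∧ tsupport f ⊆ U ∧ f ≠ 0 ∧
    R = (∫ x, ‖fderiv ℝ f x‖ ^ 2) / (∫ x, (f x) ^ 2)}

/-- The Laplacian as the sum of the unmixed second partial derivatives. -/
noncomputable def laplacian {n : ℕ} (φ : EuclideanSpace ℝ (Fin n) → ℝ)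
    (x : EuclideanSpace ℝ (Fin n)) : ℝ :=
  ∑ i : Fin n, fderiv ℝ (fun y => fderiv ℝ φ y (EuclideanSpace.single i 1)) x
    (EuclideanSpace.single i 1)

/-- `φ` is a principal Dirichlet eigenfunction of the nonempty bounded open set `U`. -/
structure IsPrincipalDirichletEigenfunction {n : ℕ} (U : Set (EuclideanSpace ℝ (Fin n)))
    (φ : EuclideanSpace ℝ (Fin n) → ℝ) : Prop where
  continuousOn : ContinuousOn φ (closure U)
  smooth : ContDiffOn ℝ (⊤ : ℕ∞) φ U
  pos : ∀ x ∈ U, 0 < φ x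
  vanishes : ∀ x ∈ frontier U, φ x = 0
  eigenEq : ∀ x ∈ U, laplacian φ x = -(dirichletEigenvalue n U) * φ x
  normalized : (∫ x in U, (φ x) ^ 2) = 1

/-- The open box `∏ i (-a i, a i)` in `ℝⁿ`. -/
def box (n : ℕ) (a : Fin n → ℝ) : Set (EuclideanSpace ℝ (Fin n)) := {x | ∀ i, |x i| < a i}

/-- The principal Dirichlet eigenfunction of the box `∏ i (-a i, a i)`. -/
noncomputable def boxEigenfunction (n : ℕ) (a : Fin n → ℝ)
    (x : EuclideanSpace ℝ (Fin n)) : ℝ :=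
  ∏ i, (1 / Real.sqrt (a i)) * Real.cos (π * x i / (2 * a i))

/-- The derivative of a twice differentiable function along a line has the second directional
derivative as its derivative. -/
lemma deriv_deriv_comp_line {E : Type*} [NormedAddCommGroup E] [NormedSpace ℝ E] {D : Set E}
    (hD : IsOpen D) {f : E → ℝ} (hf : ContDiffOn ℝ 2 f D) {x : E} (hx : x ∈ D) (v : E) :
    deriv (fun h : ℝ => f (x + h • v)) 0 = fderiv ℝ f x v ∧
    deriv (deriv (fun h : ℝ => f (x + h • v))) 0 =
      fderiv ℝ (fun y => fderiv ℝ f y v) x v := by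
  have hline : ∀ h : ℝ, HasDerivAt (fun h : ℝ => x + h • v) v h := fun h => by
    simpa using ((hasDerivAt_id h).smul_const v).const_add x
  have hdiff : ∀ y ∈ D, DifferentiableAt ℝ f y := fun y hy =>
    (hf.contDiffAt (hD.mem_nhds hy)).differentiableAt (by norm_num)
  have h1 : ∀ h : ℝ, x + h • v ∈ D →
      deriv (fun h : ℝ => f (x + h • v)) h = fderiv ℝ f (x + h • v) v := fun h hh =>
    ((hdiff _ hh).hasFDerivAt.comp_hasDerivAt h (hline h)).deriv
  have hmem : ∀ᶠ h : ℝ in nhds 0, x + h • v ∈ D := by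
    have hc : ContinuousAt (fun h : ℝ => x + h • v) 0 := (hline 0).continuousAt
    exact hc.eventually_mem (by simpa using hD.mem_nhds hx)
  refine ⟨by simpa using h1 0 (by simpa using hx), ?_⟩
  have hev : deriv (fun h : ℝ => f (x + h • v)) =ᶠ[nhds 0]
      fun h : ℝ => fderiv ℝ f (x + h • v) v := by
    filter_upwards [hmem] with h hh using h1 h hh
  rw [hev.deriv_eq]
  have hd2 : DifferentiableAt ℝ (fun y => fderiv ℝ f y v) x := by
    have : ContDiffAt ℝ 1 (fderiv ℝ f) x :=
      (hf.contDiffAt (hD.mem_nhds hx)).fderiv_right (by norm_num)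
    exact (this.differentiableAt (by norm_num)).clm_apply (differentiableAt_const v)
  have hd2' : HasFDerivAt (fun y => fderiv ℝ f y v) (fderiv ℝ (fun y => fderiv ℝ f y v) x)
      (x + (0 : ℝ) • v) := by simpa using hd2.hasFDerivAt
  exact (hd2'.comp_hasDerivAt (0 : ℝ) (hline 0)).deriv

/-- A real function with a local maximum has nonpositive second derivative there. -/
lemma IsLocalMax.deriv_deriv_nonpos {g : ℝ → ℝ} {x : ℝ} (h : IsLocalMax g x)
    (hc : ContinuousAt g x) : deriv (deriv g) x ≤ 0 := by
  by_contra! hpos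
  have hmin := isLocalMin_of_deriv_deriv_pos hpos h.deriv_eq_zero hc
  have hev : g =ᶠ[nhds x] fun _ => g x := by
    filter_upwards [h, hmin] with y h1 h2 using le_antisymm h1 h2
  have : deriv (deriv g) x = 0 := by
    rw [hev.deriv.deriv_eq]; simp
  linarith

lemma IsLocalMax.laplacian_nonpos {n : ℕ} {D : Set (EuclideanSpace ℝ (Fin n))} (hD : IsOpen D)
    {f : EuclideanSpace ℝ (Fin n) → ℝ} (hf : ContDiffOn ℝ 2 f D)
    {x : EuclideanSpace ℝ (Fin n)} (hx : x ∈ D) (hmax : IsLocalMax f x) :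
    laplacian f x ≤ 0 := by
  refine Finset.sum_nonpos fun i _ => ?_
  rw [← (deriv_deriv_comp_line hD hf hx (EuclideanSpace.single i 1)).2]
  have hc : ContinuousAt (fun h : ℝ => x + h • EuclideanSpace.single i (1 : ℝ)) 0 := by fun_prop
  have hfc : ContinuousAt f x := (hf.contDiffAt (hD.mem_nhds hx)).continuousAt
  refine IsLocalMax.deriv_deriv_nonpos ?_ ?_
  · have : Filter.Tendsto (fun h : ℝ => x + h • EuclideanSpace.single i (1 : ℝ)) (nhds 0)
        (nhds x) := by simpa [ContinuousAt] using hc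
    have := this.eventually hmax
    simpa [IsLocalMax, IsMaxFilter] using this
  · exact ContinuousAt.comp (g := f) (by simpa using hfc) hc

lemma laplacian_add {n : ℕ} {D : Set (EuclideanSpace ℝ (Fin n))} (hD : IsOpen D)
    {f g : EuclideanSpace ℝ (Fin n) → ℝ} (hf : ContDiffOn ℝ 2 f D) (hg : ContDiffOn ℝ 2 g D)
    {x : EuclideanSpace ℝ (Fin n)} (hx : x ∈ D) :
    laplacian (fun y => f y + g y) x = laplacian f x + laplacian g x := by
  unfold laplacian
  rw [← Finset.sum_add_distrib]
  refine Finset.sum_congr rfl fun i _ => ?_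
  have hd : ∀ {h : EuclideanSpace ℝ (Fin n) → ℝ}, ContDiffOn ℝ 2 h D → ∀ y ∈ D,
      DifferentiableAt ℝ h y := fun hh y hy =>
    (hh.contDiffAt (hD.mem_nhds hy)).differentiableAt (by norm_num)
  have hd2 : ∀ {h : EuclideanSpace ℝ (Fin n) → ℝ}, ContDiffOn ℝ 2 h D →
      DifferentiableAt ℝ (fun y => fderiv ℝ h y (EuclideanSpace.single i 1)) x := fun hh => by
    have : ContDiffAt ℝ 1 (fderiv ℝ _) x :=
      (hh.contDiffAt (hD.mem_nhds hx)).fderiv_right (by norm_num)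
    exact (this.differentiableAt (by norm_num)).clm_apply (differentiableAt_const _)
  have hev : (fun y => fderiv ℝ (fun y => f y + g y) y (EuclideanSpace.single i 1)) =ᶠ[nhds x]
      fun y => fderiv ℝ f y (EuclideanSpace.single i 1) +
        fderiv ℝ g y (EuclideanSpace.single i 1) := by
    filter_upwards [hD.mem_nhds hx] with y hy
    rw [fderiv_fun_add (hd hf y hy) (hd hg y hy)]; rfl
  rw [hev.fderiv_eq, fderiv_fun_add (hd2 hf) (hd2 hg)]; rfl

lemma laplacian_const_mul {n : ℕ} (c : ℝ) (f : EuclideanSpace ℝ (Fin n) → ℝ)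
    (x : EuclideanSpace ℝ (Fin n)) :
    laplacian (fun y => c * f y) x = c * laplacian f x := by
  have hmul : ∀ (g : EuclideanSpace ℝ (Fin n) → ℝ) (y v : EuclideanSpace ℝ (Fin n)),
      fderiv ℝ (fun y => c * g y) y v = c * fderiv ℝ g y v := fun g y v => by
    have : fderiv ℝ (fun y => c * g y) y = c • fderiv ℝ g y :=
      congrFun (fderiv_const_smul_field (f := g) c) y
    rw [this]; rfl
  unfold laplacian
  rw [Finset.mul_sum]
  refine Finset.sum_congr rfl fun i _ => ?_
  simp_rw [hmul]

/-- `W` is a classical solution of the heat equation on `D`, continuous up to the boundary. -/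
structure IsHeatSolution {n : ℕ} (D : Set (EuclideanSpace ℝ (Fin n)))
    (W : ℝ → EuclideanSpace ℝ (Fin n) → ℝ) : Prop where
  continuousOn : ContinuousOn (fun p : ℝ × EuclideanSpace ℝ (Fin n) => W p.1 p.2)
    (Set.univ ×ˢ closure D)
  smooth : ∀ t, ContDiffOn ℝ 2 (W t) D
  heatEq : ∀ t, ∀ x ∈ D, HasDerivAt (fun s => W s x) (laplacian (W t) x) t

namespace IsHeatSolution

variable {n : ℕ} {D : Set (EuclideanSpace ℝ (Fin n))}
  {W V : ℝ → EuclideanSpace ℝ (Fin n) → ℝ}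

lemma zero : IsHeatSolution D (fun _ _ => 0) where
  continuousOn := continuousOn_const
  smooth _ := contDiffOn_const
  heatEq t x _ := by simpa [laplacian] using hasDerivAt_const t (0 : ℝ)

lemma add (hD : IsOpen D) (hW : IsHeatSolution D W) (hV : IsHeatSolution D V) :
    IsHeatSolution D (fun t x => W t x + V t x) where
  continuousOn := hW.continuousOn.add hV.continuousOn
  smooth t := (hW.smooth t).add (hV.smooth t)
  heatEq t x hx := by
    rw [laplacian_add hD (hW.smooth t) (hV.smooth t) hx]
    exact (hW.heatEq t x hx).add (hV.heatEq t x hx)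

lemma const_mul (c : ℝ) (hW : IsHeatSolution D W) :
    IsHeatSolution D (fun t x => c * W t x) where
  continuousOn := continuousOn_const.mul hW.continuousOn
  smooth t := contDiffOn_const.mul (hW.smooth t)
  heatEq t x hx := by
    rw [laplacian_const_mul]
    exact (hW.heatEq t x hx).const_mul c

lemma sum {ι : Type*} (hD : IsOpen D) (F : Finset ι)
    {W : ι → ℝ → EuclideanSpace ℝ (Fin n) → ℝ} (hW : ∀ k, IsHeatSolution D (W k)) :
    IsHeatSolution D (fun t x => ∑ k ∈ F, W k t x) := by
  classical
  induction F using Finset.induction_on with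
  | empty => simpa using zero
  | insert k F hk ih => simpa [Finset.sum_insert hk] using (hW k).add hD ih

lemma of_eigenfunction {φ : EuclideanSpace ℝ (Fin n) → ℝ} {μ : ℝ}
    (hc : ContinuousOn φ (closure D)) (hs : ContDiffOn ℝ 2 φ D)
    (he : ∀ x ∈ D, laplacian φ x = -μ * φ x) :
    IsHeatSolution D (fun t x => exp (-μ * t) * φ x) where
  continuousOn := by
    refine ContinuousOn.mul (by fun_prop) (hc.comp continuousOn_snd fun p hp => hp.2)
  smooth t := contDiffOn_const.mul hs
  heatEq t x hx := by
    rw [laplacian_const_mul, he x hx]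
    have : HasDerivAt (fun s => exp (-μ * s)) (exp (-μ * t) * -μ) t := by
      simpa using ((hasDerivAt_id t).const_mul (-μ)).exp
    simpa [mul_assoc] using this.mul_const (φ x)

/-- The weak maximum principle for the heat equation. -/
theorem le_of_le_boundary (hD : IsOpen D) (hDb : Bornology.IsBounded D)
    (hW : IsHeatSolution D W) {ε : ℝ} (h0 : ∀ x ∈ D, W 0 x ≤ ε)
    (hbd : ∀ t, 0 ≤ t → ∀ x ∈ frontier D, W t x ≤ ε) {T : ℝ} (hT : 0 ≤ T) {x : _} (hx : x ∈ D) :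
    W T x ≤ ε := by
  by_contra! hlt
  obtain ⟨κ, hκ, hκT⟩ : ∃ κ > 0, ε < W T x - κ * T := by
    refine ⟨(W T x - ε) / (2 * (T + 1)), by have := sub_pos.2 hlt; positivity, ?_⟩
    have : (W T x - ε) / (2 * (T + 1)) * T ≤ (W T x - ε) / 2 := by
      rw [div_mul_eq_mul_div, div_le_div_iff₀ (by positivity) (by positivity)]
      nlinarith
    linarith
  have hcl : closure D = D ∪ frontier D := by
    rw [closure_eq_self_union_frontier]
  obtain ⟨⟨t₀, x₀⟩, ⟨ht₀, hx₀⟩, hmax⟩ :=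
    (isCompact_Icc (a := (0 : ℝ)) (b := T)).prod hDb.isCompact_closure |>.exists_isMaxOn
      (f := fun p => W p.1 p.2 - κ * p.1) ⟨(T, x), ⟨hT, le_rfl⟩, subset_closure hx⟩
      ((hW.continuousOn.mono (Set.prod_mono (Set.subset_univ _) le_rfl)).sub (by fun_prop))
  simp only at ht₀ hx₀
  have hval : ε < W t₀ x₀ - κ * t₀ :=
    hκT.trans_le (hmax (Set.mk_mem_prod ⟨hT, le_rfl⟩ (subset_closure hx)))
  have hκt : 0 ≤ κ * t₀ := mul_nonneg hκ.le ht₀.1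
  have hx₀D : x₀ ∈ D := by
    rcases hcl ▸ hx₀ with h | h
    · exact h
    · linarith [hbd t₀ ht₀.1 x₀ h]
  have ht₀pos : 0 < t₀ := by
    rcases ht₀.1.eq_or_lt with h | h
    · subst h
      linarith [h0 x₀ hx₀D]
    · exact h
  have hlap : laplacian (W t₀) x₀ ≤ 0 := by
    refine IsLocalMax.laplacian_nonpos hD (hW.smooth t₀) hx₀D ?_
    filter_upwards [hD.mem_nhds hx₀D] with y hy
    have := hmax (Set.mk_mem_prod ht₀ (subset_closure hy))
    simp only [Set.mem_ofPred_eq] at this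
    linarith
  have hder : HasDerivAt (fun s => W s x₀ - κ * s) (laplacian (W t₀) x₀ - κ) t₀ := by
    simpa using (hW.heatEq t₀ x₀ hx₀D).fun_sub ((hasDerivAt_id t₀).const_mul κ)
  have hlm : IsLocalMaxOn (fun s => W s x₀ - κ * s) (Set.Icc 0 t₀) t₀ := by
    filter_upwards [self_mem_nhdsWithin] with s hs
    exact hmax (Set.mk_mem_prod ⟨hs.1, hs.2.trans ht₀.2⟩ hx₀)
  have hcone : (0 : ℝ) - t₀ ∈ posTangentConeAt (Set.Icc 0 t₀) t₀ :=
    sub_mem_posTangentConeAt_of_segment_subset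
      ((convex_Icc 0 t₀).segment_subset ⟨ht₀.1, le_rfl⟩ ⟨le_rfl, ht₀.1⟩)
  have := hlm.hasFDerivWithinAt_nonpos hder.hasFDerivAt.hasFDerivWithinAt hcone
  simp at this
  nlinarith

end IsHeatSolution

/-- The Dirichlet eigenfunctions of the box `∏ i (-b i, b i)`, as products of sines. -/
noncomputable def sineProd {n : ℕ} (b : Fin n → ℝ) (k : Fin n → ℕ)
    (x : EuclideanSpace ℝ (Fin n)) : ℝ :=
  ∏ i, sin ((k i + 1) * (π * (x i + b i) / (2 * b i)))

/-- The Dirichlet eigenvalues of the box `∏ i (-b i, b i)`. -/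
noncomputable def boxFreq {n : ℕ} (b : Fin n → ℝ) (k : Fin n → ℕ) : ℝ :=
  ∑ i, ((k i + 1) * π / (2 * b i)) ^ 2

/-- The closed box `∏ i [-b i, b i]`. -/
def closedBox {n : ℕ} (b : Fin n → ℝ) : Set (EuclideanSpace ℝ (Fin n)) :=
  {x | ∀ i, |x i| ≤ b i}

section Box

variable {n : ℕ} {b : Fin n → ℝ}

lemma isOpen_box (b : Fin n → ℝ) : IsOpen (box n b) := by
  have : box n b = ⋂ i, {x : EuclideanSpace ℝ (Fin n) | |x i| < b i} := by
    ext x; simp [box]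
  rw [this]
  exact isOpen_iInter_of_finite fun i => isOpen_lt (by fun_prop) continuous_const

lemma isClosed_closedBox (b : Fin n → ℝ) : IsClosed (closedBox b) := by
  have : closedBox b = ⋂ i, {x : EuclideanSpace ℝ (Fin n) | |x i| ≤ b i} := by
    ext x; simp [closedBox]
  rw [this]
  exact isClosed_iInter fun i => isClosed_le (by fun_prop) continuous_const

lemma box_subset_closedBox : box n b ⊆ closedBox b := fun _ hx i => (hx i).le

lemma isBounded_closedBox (b : Fin n → ℝ) : Bornology.IsBounded (closedBox b) := by
  refine isBounded_iff_forall_norm_le.2 ⟨√(∑ i, (b i) ^ 2), fun x hx => ?_⟩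
  rw [EuclideanSpace.norm_eq]
  refine sqrt_le_sqrt (Finset.sum_le_sum fun i _ => ?_)
  exact pow_le_pow_left₀ (norm_nonneg _) (hx i) 2

lemma isCompact_closedBox (b : Fin n → ℝ) : IsCompact (closedBox b) :=
  Metric.isCompact_of_isClosed_isBounded (isClosed_closedBox b) (isBounded_closedBox b)

lemma isBounded_box (b : Fin n → ℝ) : Bornology.IsBounded (box n b) :=
  (isBounded_closedBox b).subset box_subset_closedBox

lemma closure_box_subset : closure (box n b) ⊆ closedBox b :=
  closure_minimal box_subset_closedBox (isClosed_closedBox b)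

lemma closedBox_subset_closure (hb : ∀ i, 0 < b i) : closedBox b ⊆ closure (box n b) := by
  intro x hx
  have ht : Filter.Tendsto (fun t : ℝ => t • x) (nhdsWithin 1 (Set.Ioo 0 1)) (nhds x) := by
    have : ContinuousAt (fun t : ℝ => t • x) 1 := by fun_prop
    simpa using this.tendsto.mono_left nhdsWithin_le_nhds
  have : (nhdsWithin (1 : ℝ) (Set.Ioo 0 1)).NeBot := by
    rw [← mem_closure_iff_nhdsWithin_neBot, closure_Ioo (by norm_num)]; simp
  refine mem_closure_of_tendsto ht ?_
  filter_upwards [self_mem_nhdsWithin] with t ht i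
  have h1 : |(t • x) i| = t * |x i| := by simp [abs_mul, abs_of_pos ht.1]
  rw [h1]
  nlinarith [hx i, ht.1, ht.2, hb i, abs_nonneg (x i)]

lemma zero_mem_box (hb : ∀ i, 0 < b i) : (0 : EuclideanSpace ℝ (Fin n)) ∈ box n b :=
  fun i => by simpa using hb i

lemma le_of_box_subset {a : Fin n → ℝ} (ha : ∀ i, 0 < a i) (h : box n a ⊆ box n b) (i : Fin n) :
    a i ≤ b i := by
  refine le_of_forall_lt fun t ht => ?_
  have hmem : EuclideanSpace.single i (max t 0) ∈ box n a := fun j => by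
    by_cases hj : j = i
    · subst hj
      simp [abs_of_nonneg (le_max_right t 0), ht, ha j]
    · simp [hj, ha j]
  have := h hmem i
  simp only [PiLp.single_apply, if_true, abs_of_nonneg (le_max_right t 0)] at this
  exact (le_max_left _ _).trans_lt this

lemma angle_mem (hb : ∀ i, 0 < b i) {x : EuclideanSpace ℝ (Fin n)} (hx : x ∈ closedBox b)
    (i : Fin n) : π * (x i + b i) / (2 * b i) ∈ Set.Icc 0 π := by
  have h := abs_le.1 (hx i)
  have hbi := hb i
  refine ⟨div_nonneg (mul_nonneg pi_pos.le (by linarith)) (by linarith), ?_⟩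
  rw [div_le_iff₀ (by linarith)]
  nlinarith [pi_pos]

lemma angle_mem_Ioo (hb : ∀ i, 0 < b i) {x : EuclideanSpace ℝ (Fin n)} (hx : x ∈ box n b)
    (i : Fin n) : π * (x i + b i) / (2 * b i) ∈ Set.Ioo 0 π := by
  have h := abs_lt.1 (hx i)
  have hbi := hb i
  refine ⟨div_pos (mul_pos pi_pos (by linarith)) (by linarith), ?_⟩
  rw [div_lt_iff₀ (by linarith)]
  nlinarith [pi_pos]

lemma abs_sin_nat_succ_mul_le (m : ℕ) {θ : ℝ} (hθ : θ ∈ Set.Icc 0 π) :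
    |sin ((m + 1) * θ)| ≤ (m + 1) * sin θ := by
  have hs := sin_nonneg_of_mem_Icc hθ
  induction m with
  | zero => simp [abs_of_nonneg hs]
  | succ m ih =>
    have : ((m + 1 : ℕ) + 1 : ℝ) * θ = (m + 1) * θ + θ := by push_cast; ring
    rw [this, sin_add]
    have h1 : |sin ((m + 1) * θ) * cos θ| ≤ |sin ((m + 1) * θ)| := by
      rw [abs_mul]; exact mul_le_of_le_one_right (abs_nonneg _) (abs_cos_le_one _)
    have h2 : |cos ((m + 1) * θ) * sin θ| ≤ sin θ := by
      rw [abs_mul, abs_of_nonneg hs]; exact mul_le_of_le_one_left hs (abs_cos_le_one _)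
    push_cast
    linarith [abs_add_le (sin ((m + 1) * θ) * cos θ) (cos ((m + 1) * θ) * sin θ)]

lemma sineProd_zero (b : Fin n → ℝ) (x : EuclideanSpace ℝ (Fin n)) :
    sineProd b 0 x = ∏ i, sin (π * (x i + b i) / (2 * b i)) := by
  simp [sineProd]

lemma sineProd_zero_nonneg (hb : ∀ i, 0 < b i) {x : EuclideanSpace ℝ (Fin n)}
    (hx : x ∈ closedBox b) : 0 ≤ sineProd b 0 x := by
  rw [sineProd_zero]
  exact Finset.prod_nonneg fun i _ => sin_nonneg_of_mem_Icc (angle_mem hb hx i)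

lemma sineProd_zero_pos (hb : ∀ i, 0 < b i) {x : EuclideanSpace ℝ (Fin n)}
    (hx : x ∈ box n b) : 0 < sineProd b 0 x := by
  rw [sineProd_zero]
  exact Finset.prod_pos fun i _ => sin_pos_of_mem_Ioo (angle_mem_Ioo hb hx i)

lemma abs_sineProd_le_one (b : Fin n → ℝ) (k : Fin n → ℕ) (x : EuclideanSpace ℝ (Fin n)) :
    |sineProd b k x| ≤ 1 := by
  rw [sineProd, Finset.abs_prod]
  exact Finset.prod_le_one (fun i _ => abs_nonneg _) fun i _ => abs_sin_le_one _

lemma abs_sineProd_le (hb : ∀ i, 0 < b i) (k : Fin n → ℕ) {x : EuclideanSpace ℝ (Fin n)}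
    (hx : x ∈ closedBox b) : |sineProd b k x| ≤ (∏ i, (k i + 1 : ℝ)) * sineProd b 0 x := by
  rw [sineProd_zero, ← Finset.prod_mul_distrib, sineProd, Finset.abs_prod]
  exact Finset.prod_le_prod (fun i _ => abs_nonneg _)
    fun i _ => abs_sin_nat_succ_mul_le _ (angle_mem hb hx i)

lemma sineProd_zero_eq_cos (hb : ∀ i, 0 < b i) (x : EuclideanSpace ℝ (Fin n)) :
    sineProd b 0 x = ∏ i, cos (π * x i / (2 * b i)) := by
  rw [sineProd_zero]
  refine Finset.prod_congr rfl fun i _ => ?_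
  have := (hb i).ne'
  rw [← sin_add_pi_div_two]
  congr 1
  field_simp

lemma sineProd_frontier (hb : ∀ i, 0 < b i) (k : Fin n → ℕ) {x : EuclideanSpace ℝ (Fin n)}
    (hx : x ∈ frontier (box n b)) : sineProd b k x = 0 := by
  rw [(isOpen_box b).frontier_eq] at hx
  have h1 := closure_box_subset hx.1
  have h2 : ∃ i, b i ≤ |x i| := by
    by_contra! h
    exact hx.2 h
  obtain ⟨i, hi⟩ := h2
  have habs : |x i| = b i := le_antisymm (h1 i) hi
  have hbi := (hb i).ne'
  refine Finset.prod_eq_zero (Finset.mem_univ i) ?_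
  rcases (abs_eq (hb i).le).1 habs with h | h
  · have : (k i + 1 : ℝ) * (π * (x i + b i) / (2 * b i)) = (k i + 1 : ℕ) * π := by
      rw [h]; push_cast; field_simp; ring
    rw [this, sin_nat_mul_pi]
  · simp [h]

lemma contDiff_sineProd (b : Fin n → ℝ) (k : Fin n → ℕ) {m : WithTop ℕ∞} :
    ContDiff ℝ m (sineProd b k) := by
  refine contDiff_prod fun i _ => ?_
  refine contDiff_sin.comp ?_
  simp only [div_eq_mul_inv]
  fun_prop

/-- Differentiating a product of functions of the separate coordinates. -/
lemma fderiv_prod_coord {F : Fin n → ℝ → ℝ} {F' : ℝ → ℝ} {i : Fin n}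
    (hF : ∀ j, Differentiable ℝ (F j)) (hF' : ∀ t, HasDerivAt (F i) (F' t) t)
    (x : EuclideanSpace ℝ (Fin n)) :
    fderiv ℝ (fun y : EuclideanSpace ℝ (Fin n) => ∏ j, F j (y j)) x (EuclideanSpace.single i 1) =
      F' (x i) * ∏ j ∈ Finset.univ.erase i, F j (x j) := by
  have hd : DifferentiableAt ℝ (fun y : EuclideanSpace ℝ (Fin n) => ∏ j, F j (y j)) x := by
    refine (HasFDerivAt.finsetProd (g := fun j (y : EuclideanSpace ℝ (Fin n)) => F j (y j))
      fun j _ => DifferentiableAt.hasFDerivAt ?_).differentiableAt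
    exact (hF j (x j)).comp (f := fun y : EuclideanSpace ℝ (Fin n) => y j) x (by fun_prop)
  rw [← hd.lineDeriv_eq_fderiv, lineDeriv]
  have : (fun t : ℝ => ∏ j, F j ((x + t • EuclideanSpace.single i (1 : ℝ)) j)) =
      fun t => F i (x i + t) * ∏ j ∈ Finset.univ.erase i, F j (x j) := by
    funext t
    rw [← Finset.mul_prod_erase Finset.univ _ (Finset.mem_univ i)]
    congr 1
    · simp
    · refine Finset.prod_congr rfl fun j hj => ?_
      simp [Finset.ne_of_mem_erase hj]
  rw [this]
  have h1 : HasDerivAt (fun t => F i (x i + t)) (F' (x i)) 0 := by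
    have := (hF' (x i + 0)).comp_const_add (x i) 0
    simpa using this
  exact (h1.mul_const _).deriv

lemma laplacian_sineProd (b : Fin n → ℝ) (k : Fin n → ℕ) (x : EuclideanSpace ℝ (Fin n)) :
    laplacian (sineProd b k) x = -boxFreq b k * sineProd b k x := by
  unfold laplacian boxFreq
  rw [neg_mul, Finset.sum_mul, ← Finset.sum_neg_distrib]
  refine Finset.sum_congr rfl fun i _ => ?_
  set ω : Fin n → ℝ := fun j => (k j + 1) * π / (2 * b j) with hω
  set F : Fin n → ℝ → ℝ := fun j t => sin (ω j * (t + b j)) with hF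
  have hs : sineProd b k = fun y => ∏ j, F j (y j) := by
    funext y
    refine Finset.prod_congr rfl fun j _ => ?_
    simp only [hF, hω]
    congr 1
    ring
  have hinner : ∀ j t, HasDerivAt (fun t => ω j * (t + b j)) (ω j) t := fun j t => by
    simpa using ((hasDerivAt_id t).add_const (b j)).const_mul (ω j)
  have hd1 : ∀ j t, HasDerivAt (F j) (cos (ω j * (t + b j)) * ω j) t := fun j t =>
    (hinner j t).sin
  have hd2 : ∀ t, HasDerivAt (fun t => cos (ω i * (t + b i)) * ω i)
      (-(ω i) ^ 2 * sin (ω i * (t + b i))) t := fun t => by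
    have := (hinner i t).cos.mul_const (ω i)
    exact this.congr_deriv (by ring)
  have hFd : ∀ j, Differentiable ℝ (F j) := fun j t => (hd1 j t).differentiableAt
  set G : Fin n → ℝ → ℝ := Function.update F i (fun t => cos (ω i * (t + b i)) * ω i) with hG
  have hGi : G i = fun t => cos (ω i * (t + b i)) * ω i := by simp [hG]
  have hGj : ∀ j, j ≠ i → G j = F j := fun j hj => by simp [hG, hj]
  have herase : ∀ y : EuclideanSpace ℝ (Fin n), ∏ j ∈ Finset.univ.erase i, G j (y j) =
      ∏ j ∈ Finset.univ.erase i, F j (y j) := fun y =>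
    Finset.prod_congr rfl fun j hj => by rw [hGj j (Finset.ne_of_mem_erase hj)]
  have h1 : (fun y => fderiv ℝ (sineProd b k) y (EuclideanSpace.single i 1)) =
      fun y => ∏ j, G j (y j) := by
    funext y
    rw [hs, fderiv_prod_coord hFd (hd1 i) y,
      ← Finset.mul_prod_erase Finset.univ _ (Finset.mem_univ i), herase, hGi]
  have hGd : ∀ j, Differentiable ℝ (G j) := fun j => by
    by_cases hj : j = i
    · subst hj
      rw [hGi]
      exact fun t => (hd2 t).differentiableAt
    · rw [hGj j hj]; exact hFd j
  rw [h1, fderiv_prod_coord hGd (by rw [hGi]; exact hd2) x, herase, hs]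
  simp only
  rw [← Finset.mul_prod_erase Finset.univ _ (Finset.mem_univ i)]
  simp only [hF]
  ring

/-- The heat solution on the box with initial datum a finite combination of sine products. -/
lemma isHeatSolution_sineProd (b : Fin n → ℝ) {D : Set (EuclideanSpace ℝ (Fin n))}
    (hD : IsOpen D) (F : Finset (Fin n → ℕ)) (c : (Fin n → ℕ) → ℝ) :
    IsHeatSolution D (fun t x => ∑ k ∈ F, c k * (exp (-boxFreq b k * t) * sineProd b k x)) :=
  IsHeatSolution.sum hD F fun k => (IsHeatSolution.of_eigenfunction
    (contDiff_sineProd b k (m := 0)).continuous.continuousOn (contDiff_sineProd b k).contDiffOn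
    fun x _ => laplacian_sineProd b k x).const_mul (c k)

end Box

section Integrals

variable {n : ℕ} {b : Fin n → ℝ}

lemma setIntegral_box_prod (b : Fin n → ℝ) (f : Fin n → ℝ → ℝ) :
    ∫ x in box n b, ∏ i, f i (x i) = ∏ i, ∫ t in Set.Ioo (-b i) (b i), f i t := by
  rw [← integral_indicator (isOpen_box b).measurableSet]
  have h1 : ∀ x : EuclideanSpace ℝ (Fin n), (box n b).indicator (fun x => ∏ i, f i (x i)) x =
      ∏ i, (Set.Ioo (-b i) (b i)).indicator (f i) (x i) := fun x => by
    by_cases hx : x ∈ box n b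
    · rw [Set.indicator_of_mem hx]
      exact Finset.prod_congr rfl fun i _ => by
        exact (Set.indicator_of_mem (s := Set.Ioo (-b i) (b i)) (abs_lt.1 (hx i)) _).symm
    · rw [Set.indicator_of_notMem hx]
      obtain ⟨i, hi⟩ := not_forall.1 hx
      refine (Finset.prod_eq_zero (Finset.mem_univ i) ?_).symm
      exact Set.indicator_of_notMem (s := Set.Ioo (-b i) (b i)) (fun h => hi (abs_lt.2 h)) _
  simp_rw [h1]
  have h2 := (EuclideanSpace.volume_preserving_symm_measurableEquiv_toLp (Fin n)).integral_comp'
    (fun y : Fin n → ℝ => ∏ i, (Set.Ioo (-b i) (b i)).indicator (f i) (y i))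
  refine h2.trans ?_
  rw [integral_fintype_prod_volume_eq_prod]
  exact Finset.prod_congr rfl fun i _ => integral_indicator measurableSet_Ioo

lemma volume_real_box (hb : ∀ i, 0 < b i) : volume.real (box n b) = ∏ i, (2 * b i) := by
  have h := setIntegral_box_prod b (fun _ _ => 1)
  simp only [Finset.prod_const_one, setIntegral_const, smul_eq_mul, mul_one] at h
  rw [h]
  refine Finset.prod_congr rfl fun i _ => ?_
  rw [measureReal_def, Real.volume_Ioo, ENNReal.toReal_ofReal (by linarith [hb i])]
  ring

lemma setIntegral_cos_int_mul {β : ℝ} (hβ : 0 < β) (m : ℤ) :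
    ∫ t in Set.Ioo (-β) β, cos (m * (π * (t + β) / (2 * β))) = if m = 0 then 2 * β else 0 := by
  rw [← integral_Ioc_eq_integral_Ioo, ← intervalIntegral.integral_of_le (by linarith)]
  split_ifs with hm
  · subst hm
    simp
    ring
  · have hm' : (m : ℝ) ≠ 0 := by exact_mod_cast hm
    have hπ := pi_ne_zero
    have hd : ∀ t : ℝ, HasDerivAt
        (fun t => 2 * β / (m * π) * sin (m * (π * (t + β) / (2 * β))))
        (cos (m * (π * (t + β) / (2 * β)))) t := fun t => by
      have h1 : HasDerivAt (fun t => m * (π * (t + β) / (2 * β))) (m * (π / (2 * β))) t := by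
        simpa using
          ((((hasDerivAt_id t).add_const β).const_mul π).div_const (2 * β)).const_mul (m : ℝ)
      refine (h1.sin.const_mul (2 * β / (m * π))).congr_deriv ?_
      field_simp
    rw [intervalIntegral.integral_eq_sub_of_hasDerivAt (fun t _ => hd t)
      (Continuous.intervalIntegrable (by fun_prop) _ _)]
    have h2 : (m : ℝ) * (π * (β + β) / (2 * β)) = m * π := by field_simp; ring
    rw [h2, sin_int_mul_pi]
    simp

lemma setIntegral_sin_mul_sin {β : ℝ} (hβ : 0 < β) (k l : ℕ) :
    ∫ t in Set.Ioo (-β) β, sin ((k + 1) * (π * (t + β) / (2 * β))) *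
      sin ((l + 1) * (π * (t + β) / (2 * β))) = if k = l then β else 0 := by
  have h : ∀ t : ℝ, sin ((k + 1) * (π * (t + β) / (2 * β))) *
      sin ((l + 1) * (π * (t + β) / (2 * β))) =
      (cos (((k - l : ℤ) : ℝ) * (π * (t + β) / (2 * β))) -
        cos (((k + l + 2 : ℤ) : ℝ) * (π * (t + β) / (2 * β)))) / 2 := fun t => by
    have e1 : ((k - l : ℤ) : ℝ) * (π * (t + β) / (2 * β)) =
      (k + 1) * (π * (t + β) / (2 * β)) - (l + 1) * (π * (t + β) / (2 * β)) := by
      push_cast; ring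
    have e2 : ((k + l + 2 : ℤ) : ℝ) * (π * (t + β) / (2 * β)) =
      (k + 1) * (π * (t + β) / (2 * β)) + (l + 1) * (π * (t + β) / (2 * β)) := by
      push_cast; ring
    rw [e1, e2, cos_sub, cos_add]
    ring
  have hcosInt : ∀ m : ℤ, IntegrableOn (fun t : ℝ => cos (m * (π * (t + β) / (2 * β))))
      (Set.Ioo (-β) β) := fun m =>
    ((Continuous.continuousOn (by fun_prop)).integrableOn_compact isCompact_Icc).mono_set
      Set.Ioo_subset_Icc_self
  simp_rw [h]
  rw [integral_div, integral_sub (hcosInt _) (hcosInt _), setIntegral_cos_int_mul hβ,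
    setIntegral_cos_int_mul hβ, if_neg (by omega : ¬ ((k : ℤ) + l + 2 = 0))]
  by_cases hkl : k = l
  · simp [hkl]
  · rw [if_neg hkl, if_neg (by omega)]
    simp

lemma setIntegral_sineProd_mul (hb : ∀ i, 0 < b i) (k l : Fin n → ℕ) :
    ∫ x in box n b, sineProd b k x * sineProd b l x = if k = l then ∏ i, b i else 0 := by
  simp_rw [sineProd, ← Finset.prod_mul_distrib]
  rw [setIntegral_box_prod b (fun i t => sin ((k i + 1) * (π * (t + b i) / (2 * b i))) *
      sin ((l i + 1) * (π * (t + b i) / (2 * b i))))]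
  simp_rw [setIntegral_sin_mul_sin (hb _)]
  split_ifs with h
  · subst h; simp
  · obtain ⟨i, hi⟩ := Function.ne_iff.1 h
    exact Finset.prod_eq_zero (Finset.mem_univ i) (by simp [hi])

lemma continuous_sineProd (b : Fin n → ℝ) (k : Fin n → ℕ) : Continuous (sineProd b k) :=
  (contDiff_sineProd b k (m := 0)).continuous

lemma integrableOn_box {f : EuclideanSpace ℝ (Fin n) → ℝ} (hf : ContinuousOn f (closedBox b)) :
    IntegrableOn f (box n b) :=
  (hf.integrableOn_compact (isCompact_closedBox b)).mono_set box_subset_closedBox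

lemma setIntegral_sum_sineProd_mul (hb : ∀ i, 0 < b i) (F : Finset (Fin n → ℕ))
    (c : (Fin n → ℕ) → ℝ) {l : Fin n → ℕ} (hl : l ∈ F) :
    ∫ x in box n b, (∑ k ∈ F, c k * sineProd b k x) * sineProd b l x = c l * ∏ i, b i := by
  simp_rw [Finset.sum_mul, mul_assoc]
  have hcont : ∀ k, Continuous fun x => c k * (sineProd b k x * sineProd b l x) := fun k =>
    continuous_const.mul ((continuous_sineProd b k).mul (continuous_sineProd b l))
  rw [integral_finsetSum F fun k _ => integrableOn_box (hcont k).continuousOn]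
  simp_rw [integral_const_mul, setIntegral_sineProd_mul hb]
  simp [hl]

/-- Bessel's inequality for a single coefficient of a sine polynomial. -/
lemma sq_coeff_mul_le (hb : ∀ i, 0 < b i) (F : Finset (Fin n → ℕ))
    (c : (Fin n → ℕ) → ℝ) {l : Fin n → ℕ} (hl : l ∈ F) :
    c l ^ 2 * ∏ i, b i ≤ ∫ x in box n b, (∑ k ∈ F, c k * sineProd b k x) ^ 2 := by
  set P : EuclideanSpace ℝ (Fin n) → ℝ := fun x => ∑ k ∈ F, c k * sineProd b k x with hP
  have hPc : Continuous P :=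
    continuous_finsetSum _ fun k _ => continuous_const.mul (continuous_sineProd b k)
  have hsc := continuous_sineProd b l
  have h0 : 0 ≤ ∫ x in box n b, (P x - c l * sineProd b l x) ^ 2 :=
    integral_nonneg fun x => sq_nonneg _
  have h1 : ∀ x, (P x - c l * sineProd b l x) ^ 2 = P x ^ 2 - 2 * c l * (P x * sineProd b l x) +
      c l ^ 2 * (sineProd b l x * sineProd b l x) := fun x => by ring
  simp_rw [h1] at h0
  rw [integral_add, integral_sub, integral_const_mul, integral_const_mul,
    setIntegral_sum_sineProd_mul hb F c hl, setIntegral_sineProd_mul hb, if_pos rfl] at h0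
  · linarith
  all_goals exact integrableOn_box (Continuous.continuousOn (by fun_prop))

lemma cos_mul_sineProd_mem_span (b : Fin n → ℝ) (j : Fin n) (k : Fin n → ℕ) :
    (fun x : closedBox b => cos (π * (x.1 j + b j) / (2 * b j)) * sineProd b k x.1) ∈
      Submodule.span ℝ (Set.range fun (k : Fin n → ℕ) (x : closedBox b) => sineProd b k x.1) := by
  classical
  have hprod : ∀ (k' : Fin n → ℕ) (x : EuclideanSpace ℝ (Fin n)), (∀ i, i ≠ j → k' i = k i) →
      sineProd b k' x = sin ((k' j + 1) * (π * (x j + b j) / (2 * b j))) *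
        ∏ i ∈ Finset.univ.erase j, sin ((k i + 1) * (π * (x i + b i) / (2 * b i))) :=
    fun k' x h => by
      rw [sineProd, ← Finset.mul_prod_erase Finset.univ _ (Finset.mem_univ j)]
      congr 1
      exact Finset.prod_congr rfl fun i hi => by rw [h i (Finset.ne_of_mem_erase hi)]
  have hup : ∀ m i, i ≠ j → Function.update k j m i = k i := fun m i hi => by simp [hi]
  have hmem : ∀ k' : Fin n → ℕ, (fun x : closedBox b => sineProd b k' x.1) ∈
      Submodule.span ℝ (Set.range fun (k : Fin n → ℕ) (x : closedBox b) => sineProd b k x.1) :=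
    fun k' => Submodule.subset_span ⟨k', rfl⟩
  rcases hk : k j with _ | m
  · have : (fun x : closedBox b => cos (π * (x.1 j + b j) / (2 * b j)) * sineProd b k x.1) =
        (1 / 2 : ℝ) • fun x : closedBox b => sineProd b (Function.update k j 1) x.1 := by
      funext x
      simp only [Pi.smul_apply, smul_eq_mul]
      rw [hprod k x.1 (fun _ _ => rfl), hprod _ x.1 (hup 1), hk]
      simp only [Function.update_self]
      have : (((1 : ℕ) : ℝ) + 1) = 2 := by norm_num
      rw [this, sin_two_mul]
      push_cast
      ring_nf
    rw [this]
    exact Submodule.smul_mem _ _ (hmem _)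
  · have : (fun x : closedBox b => cos (π * (x.1 j + b j) / (2 * b j)) * sineProd b k x.1) =
        (1 / 2 : ℝ) • ((fun x : closedBox b => sineProd b (Function.update k j (m + 2)) x.1) +
          fun x : closedBox b => sineProd b (Function.update k j m) x.1) := by
      funext x
      simp only [Pi.smul_apply, Pi.add_apply, smul_eq_mul]
      rw [hprod k x.1 (fun _ _ => rfl), hprod _ x.1 (hup (m + 2)), hprod _ x.1 (hup m), hk]
      simp only [Function.update_self]
      set θ := π * (x.1 j + b j) / (2 * b j)
      have e1 : (((m + 2 : ℕ) : ℝ) + 1) * θ = ((m + 1 : ℕ) + 1) * θ + θ := by push_cast; ring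
      have e2 : ((m : ℝ) + 1) * θ = ((m + 1 : ℕ) + 1) * θ - θ := by push_cast; ring
      rw [e1, e2, sin_add, sin_sub]
      ring
    rw [this]
    exact Submodule.smul_mem _ _ (Submodule.add_mem _ (hmem _) (hmem _))

/-- If the generators of an algebra of functions map the generators of a submodule into it, then
so do all elements of the algebra. -/
lemma mul_mem_of_mem_adjoin {X : Type*} [TopologicalSpace X] (G : Set C(X, ℝ))
    (R : Set (X → ℝ)) (h : ∀ g ∈ G, ∀ r ∈ R, ⇑g * r ∈ Submodule.span ℝ R) :
    ∀ f ∈ Algebra.adjoin ℝ G, ∀ s ∈ Submodule.span ℝ R, ⇑f * s ∈ Submodule.span ℝ R := by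
  intro f hf
  induction hf using Algebra.adjoin_induction with
  | mem f hf =>
    intro s hs
    induction hs using Submodule.span_induction with
    | mem s hs => exact h f hf s hs
    | zero => rw [mul_zero]; exact Submodule.zero_mem _
    | add s t _ _ hs ht => rw [mul_add]; exact Submodule.add_mem _ hs ht
    | smul a s _ hs => rw [mul_smul_comm]; exact Submodule.smul_mem _ a hs
  | algebraMap r => exact fun s hs => Submodule.smul_mem _ r hs
  | add f f' _ _ hf hf' =>
    intro s hs
    rw [ContinuousMap.coe_add, add_mul]
    exact Submodule.add_mem _ (hf s hs) (hf' s hs)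
  | mul f f' _ _ hf hf' =>
    intro s hs
    rw [ContinuousMap.coe_mul, mul_assoc]
    exact hf _ (hf' s hs)

/-- Functions on a closed box that are divisible by the ground state are uniform limits of sine
polynomials. -/
lemma exists_sineProd_approx (hb : ∀ i, 0 < b i) {h : EuclideanSpace ℝ (Fin n) → ℝ}
    (hh : ContinuousOn h (closedBox b)) {ε : ℝ} (hε : 0 < ε) :
    ∃ (F : Finset (Fin n → ℕ)) (c : (Fin n → ℕ) → ℝ), 0 ∈ F ∧ ∀ x ∈ closedBox b,
      |(∑ k ∈ F, c k * sineProd b k x) - h x * sineProd b 0 x| ≤ ε := by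
  classical
  have : CompactSpace (closedBox b) := isCompact_iff_compactSpace.1 (isCompact_closedBox b)
  let g : Fin n → C(closedBox b, ℝ) := fun j =>
    ⟨fun x => cos (π * (x.1 j + b j) / (2 * b j)), by fun_prop⟩
  set A : Subalgebra ℝ C(closedBox b, ℝ) := Algebra.adjoin ℝ (Set.range g) with hA
  set S := Submodule.span ℝ
    (Set.range fun (k : Fin n → ℕ) (x : closedBox b) => sineProd b k x.1) with hS
  have hsep : A.SeparatesPoints := by
    intro x y hxy
    have : ∃ j, x.1 j ≠ y.1 j := by
      by_contra! hcon
      exact hxy (Subtype.ext (PiLp.ext hcon))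
    obtain ⟨j, hj⟩ := this
    refine ⟨g j, ⟨g j, Algebra.subset_adjoin ⟨j, rfl⟩, rfl⟩, fun heq => hj ?_⟩
    have := injOn_cos (angle_mem hb x.2 j) (angle_mem hb y.2 j) heq
    have hbj := (hb j).ne'
    have hπ := pi_ne_zero
    field_simp at this
    linarith
  have hmul : ∀ f ∈ A, ∀ s ∈ S, ⇑f * s ∈ S := mul_mem_of_mem_adjoin (Set.range g) _ <| by
    rintro _ ⟨j, rfl⟩ _ ⟨k, rfl⟩
    exact cos_mul_sineProd_mem_span b j k
  obtain ⟨⟨q, hq⟩, hqε⟩ := ContinuousMap.exists_mem_subalgebra_near_continuous_of_separatesPoints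
    A hsep (fun x => h x.1) (continuousOn_iff_continuous_domRestrict.1 hh) ε hε
  have hqS := hmul q hq _ (Submodule.subset_span ⟨0, rfl⟩)
  rw [hS, Finsupp.mem_span_range_iff_exists_finsupp] at hqS
  obtain ⟨c, hc⟩ := hqS
  refine ⟨insert 0 c.support, c, Finset.mem_insert_self _ _, fun x hx => ?_⟩
  have h1 : ∑ k ∈ insert 0 c.support, c k * sineProd b k x = q ⟨x, hx⟩ * sineProd b 0 x := by
    have h2 := congrFun hc ⟨x, hx⟩
    rw [Finsupp.sum, Finset.sum_apply] at h2
    simp only [Pi.smul_apply, Pi.mul_apply, smul_eq_mul] at h2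
    rw [← h2]
    refine (Finset.sum_subset (Finset.subset_insert _ _) fun k _ hk => ?_).symm
    rw [Finsupp.notMem_support_iff.1 hk, zero_mul]
  rw [h1, ← sub_mul, abs_mul]
  have h3 := (hqε ⟨x, hx⟩).le
  rw [norm_eq_abs] at h3
  exact (mul_le_mul h3 (abs_sineProd_le_one b 0 x) (abs_nonneg _) hε.le).trans_eq (mul_one ε)

end Integrals

section Estimates

variable {n : ℕ} {b : Fin n → ℝ}

lemma exp_boxFreq_mul_abs_sineProd_le (hb : ∀ i, 0 < b i) {τ T : ℝ} (hτ : 0 ≤ τ)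
    (hT : ∀ i, τ * b i ^ 2 ≤ T) (k : Fin n → ℕ) {x : EuclideanSpace ℝ (Fin n)}
    (hx : x ∈ closedBox b) :
    exp (-boxFreq b k * T) * |sineProd b k x| ≤
      exp (-boxFreq b 0 * T) * sineProd b 0 x * ∏ i, (2 * exp (-τ)) ^ k i := by
  have hfreq : ∀ k' : Fin n → ℕ, exp (-boxFreq b k' * T) =
      ∏ i, exp (-((k' i + 1) * π / (2 * b i)) ^ 2 * T) := fun k' => by
    rw [← exp_sum, boxFreq, neg_mul, Finset.sum_mul, ← Finset.sum_neg_distrib]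
    simp_rw [neg_mul]
  have hcoord : ∀ i, exp (-((k i + 1) * π / (2 * b i)) ^ 2 * T) * (k i + 1) ≤
      exp (-(((0 : Fin n → ℕ) i + 1) * π / (2 * b i)) ^ 2 * T) * (2 * exp (-τ)) ^ k i := by
    intro i
    have hbi := hb i
    have h1 : -((k i + 1) * π / (2 * b i)) ^ 2 * T ≤
        -(((0 : Fin n → ℕ) i + 1) * π / (2 * b i)) ^ 2 * T + (k i : ℝ) * -τ := by
      have hr : τ ≤ T / b i ^ 2 := (le_div_iff₀ (by positivity)).2 (hT i)
      have e : ((k i + 1) * π / (2 * b i)) ^ 2 * T -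
          (((0 : Fin n → ℕ) i + 1) * π / (2 * b i)) ^ 2 * T =
          π ^ 2 / 4 * ((k i : ℝ) * (k i + 2)) * (T / b i ^ 2) := by
        simp only [Pi.zero_apply]
        push_cast
        field_simp
        ring
      have hk : (0 : ℝ) ≤ k i := Nat.cast_nonneg _
      have hπ : 2 ≤ π ^ 2 / 4 := by nlinarith [pi_gt_three]
      have h2 : (k i : ℝ) ≤ π ^ 2 / 4 * ((k i : ℝ) * (k i + 2)) := by
        have h3 : (k i : ℝ) ≤ (k i : ℝ) * (k i + 2) := by nlinarith
        nlinarith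
      have h4 : (k i : ℝ) * τ ≤ π ^ 2 / 4 * ((k i : ℝ) * (k i + 2)) * (T / b i ^ 2) :=
        mul_le_mul h2 hr hτ (hk.trans h2)
      linarith
    have h2 : ((k i : ℝ) + 1) ≤ 2 ^ k i := by
      exact_mod_cast Nat.lt_two_pow_self
    rw [mul_pow, ← exp_nat_mul]
    calc _ ≤ (exp (-(((0 : Fin n → ℕ) i + 1) * π / (2 * b i)) ^ 2 * T) *
          exp ((k i : ℝ) * -τ)) * 2 ^ k i := by
          rw [← exp_add]
          gcongr
      _ = _ := by ring
  calc exp (-boxFreq b k * T) * |sineProd b k x|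
      ≤ exp (-boxFreq b k * T) * ((∏ i, (k i + 1 : ℝ)) * sineProd b 0 x) := by
        gcongr
        exact abs_sineProd_le hb k hx
    _ = (∏ i, exp (-((k i + 1) * π / (2 * b i)) ^ 2 * T) * (k i + 1)) * sineProd b 0 x := by
        rw [hfreq k, Finset.prod_mul_distrib]; ring
    _ ≤ (∏ i, exp (-(((0 : Fin n → ℕ) i + 1) * π / (2 * b i)) ^ 2 * T) *
          (2 * exp (-τ)) ^ k i) * sineProd b 0 x := by
        refine mul_le_mul_of_nonneg_right ?_ (sineProd_zero_nonneg hb hx)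
        exact Finset.prod_le_prod (fun i _ => by positivity) fun i _ => hcoord i
    _ = _ := by rw [hfreq 0, Finset.prod_mul_distrib]; ring

lemma sum_prod_pow_le {q : ℝ} (hq0 : 0 ≤ q) (hq1 : q < 1) (F : Finset (Fin n → ℕ)) :
    ∑ k ∈ F, ∏ i, q ^ k i ≤ ((1 - q)⁻¹) ^ n := by
  classical
  set N := F.sup (fun k => Finset.univ.sup k) + 1
  have hsub : F ⊆ Fintype.piFinset fun _ => Finset.range N := fun k hk => by
    rw [Fintype.mem_piFinset]
    intro i
    have h1 : k i ≤ Finset.univ.sup k := Finset.le_sup (Finset.mem_univ i)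
    have h2 : Finset.univ.sup k ≤ F.sup (fun k => Finset.univ.sup k) :=
      Finset.le_sup (f := fun k : Fin n → ℕ => Finset.univ.sup k) hk
    exact Finset.mem_range.2 (by omega)
  calc ∑ k ∈ F, ∏ i, q ^ k i ≤ ∑ k ∈ Fintype.piFinset fun _ => Finset.range N, ∏ i, q ^ k i :=
        Finset.sum_le_sum_of_subset_of_nonneg hsub fun k _ _ =>
          Finset.prod_nonneg fun i _ => pow_nonneg hq0 _
    _ = ∏ _i : Fin n, ∑ m ∈ Finset.range N, q ^ m := by rw [Finset.prod_univ_sum]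
    _ ≤ ∏ _i : Fin n, (1 - q)⁻¹ := by
        refine Finset.prod_le_prod (fun i _ => Finset.sum_nonneg fun m _ => pow_nonneg hq0 m)
          fun i _ => ?_
        rw [← tsum_geometric_of_lt_one hq0 hq1]
        exact (summable_geometric_of_lt_one hq0 hq1).sum_le_tsum _ fun m _ => pow_nonneg hq0 m
    _ = _ := by simp

/-- Coefficients of a sine polynomial uniformly close to a function of unit energy. -/
lemma abs_coeff_le (hb : ∀ i, 0 < b i) {F : Finset (Fin n → ℕ)} {c : (Fin n → ℕ) → ℝ}
    {g : EuclideanSpace ℝ (Fin n) → ℝ} (hg : ContinuousOn g (closedBox b))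
    (hg1 : ∫ x in box n b, g x ^ 2 ≤ 1) {ε : ℝ} (hε : ε ^ 2 * volume.real (box n b) ≤ 1)
    (happ : ∀ x ∈ closedBox b, |(∑ k ∈ F, c k * sineProd b k x) - g x| ≤ ε)
    {l : Fin n → ℕ} (hl : l ∈ F) : |c l| ≤ 2 / √(∏ i, b i) := by
  have hB : 0 < ∏ i, b i := Finset.prod_pos fun i _ => hb i
  have hPc : Continuous fun x => ∑ k ∈ F, c k * sineProd b k x :=
    continuous_finsetSum _ fun k _ => continuous_const.mul (continuous_sineProd b k)
  have hconst : IntegrableOn (fun _ => 2 * ε ^ 2) (box n b) :=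
    integrableOn_box (b := b) continuousOn_const
  have hg2 : IntegrableOn (fun x => 2 * g x ^ 2) (box n b) :=
    integrableOn_box (continuousOn_const.mul (hg.pow 2))
  have h1 : ∫ x in box n b, (∑ k ∈ F, c k * sineProd b k x) ^ 2 ≤
      ∫ x in box n b, (2 * g x ^ 2 + 2 * ε ^ 2) := by
    refine setIntegral_mono_on (integrableOn_box (hPc.pow 2).continuousOn)
      (hg2.add hconst) (isOpen_box b).measurableSet fun x hx => ?_
    have h := happ x (box_subset_closedBox hx)
    have h2 := sq_le_sq' (abs_le.1 h).1 (abs_le.1 h).2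
    nlinarith [sq_nonneg ((∑ k ∈ F, c k * sineProd b k x) - 2 * g x)]
  rw [integral_add hg2 hconst, integral_const_mul, setIntegral_const, smul_eq_mul] at h1
  have h3 := sq_coeff_mul_le hb F c hl
  have h4 : |c l| ^ 2 ≤ (2 / √(∏ i, b i)) ^ 2 := by
    rw [sq_abs, div_pow, sq_sqrt hB.le, le_div_iff₀ hB]
    linarith
  exact (sq_le_sq₀ (abs_nonneg _) (by positivity)).1 h4

lemma le_of_forall_small_pos {X Y K V : ℝ} (h : ∀ ε > 0, ε ^ 2 * V ≤ 1 → X ≤ Y + ε * K) :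
    X ≤ Y := by
  have h1 : Filter.Tendsto (fun ε : ℝ => Y + ε * K) (nhdsWithin 0 (Set.Ioi 0)) (nhds Y) := by
    have : ContinuousAt (fun ε : ℝ => Y + ε * K) 0 := by fun_prop
    simpa using this.tendsto.mono_left nhdsWithin_le_nhds
  have h2 : ∀ᶠ ε : ℝ in nhdsWithin 0 (Set.Ioi 0), ε ^ 2 * V ≤ 1 := by
    have : ContinuousAt (fun ε : ℝ => ε ^ 2 * V) 0 := by fun_prop
    have h3 : ∀ᶠ ε : ℝ in nhds 0, ε ^ 2 * V < 1 := this.eventually_lt_const (by simp)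
    exact (h3.filter_mono nhdsWithin_le_nhds).mono fun _ h => h.le
  refine ge_of_tendsto h1 ?_
  filter_upwards [h2, self_mem_nhdsWithin] with ε hε hpos using h ε hpos hε

end Estimates

namespace IsPrincipalDirichletEigenfunction

variable {n : ℕ} {b : Fin n → ℝ} {U : Set (EuclideanSpace ℝ (Fin n))}
  {φ : EuclideanSpace ℝ (Fin n) → ℝ}

lemma isHeatSolution (hφ : IsPrincipalDirichletEigenfunction U φ) {D : Set _} (hDU : D ⊆ U) :
    IsHeatSolution D (fun t x => exp (-dirichletEigenvalue n U * t) * φ x) :=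
  IsHeatSolution.of_eigenfunction (hφ.continuousOn.mono (closure_mono hDU))
    ((contDiffOn_infty.1 hφ.smooth 2).mono hDU) fun x hx => hφ.eigenEq x (hDU hx)

lemma nonneg_of_mem_closure (hφ : IsPrincipalDirichletEigenfunction U φ)
    {x : EuclideanSpace ℝ (Fin n)} (hx : x ∈ closure U) : 0 ≤ φ x := by
  rw [closure_eq_self_union_frontier] at hx
  rcases hx with h | h
  · exact (hφ.pos x h).le
  · exact (hφ.vanishes x h).ge

lemma integrableOn_sq (hφ : IsPrincipalDirichletEigenfunction U φ) :
    IntegrableOn (fun x => φ x ^ 2) U := by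
  by_contra h
  have h1 := hφ.normalized
  rw [integral_undef h] at h1
  exact zero_ne_one h1

lemma setIntegral_sq_le_one (hφ : IsPrincipalDirichletEigenfunction U φ) {D : Set _}
    (hDU : D ⊆ U) : ∫ x in D, φ x ^ 2 ≤ 1 := by
  rw [← hφ.normalized]
  exact setIntegral_mono_set hφ.integrableOn_sq (Filter.Eventually.of_forall fun x => sq_nonneg _)
    hDU.eventuallyLE

lemma continuous_indicator (hφ : IsPrincipalDirichletEigenfunction U φ) :
    Continuous (U.indicator φ) :=
  _root_.continuous_indicator hφ.vanishes hφ.continuousOn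

lemma indicator_nonneg (hφ : IsPrincipalDirichletEigenfunction U φ)
    (x : EuclideanSpace ℝ (Fin n)) : 0 ≤ U.indicator φ x :=
  Set.indicator_nonneg (fun y hy => (hφ.pos y hy).le) x

/-- The truncation `(φ - ε)₊` of a principal eigenfunction is divisible by the ground state of any
box containing its domain. -/
lemma continuousOn_truncation_div (hφ : IsPrincipalDirichletEigenfunction U φ)
    (hb : ∀ i, 0 < b i) (hU : U ⊆ box n b) {ε : ℝ} (hε : 0 < ε) :
    Continuous fun x => max (U.indicator φ x - ε) 0 / sineProd b 0 x := by
  rw [continuous_iff_continuousAt]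
  intro x
  rcases lt_or_ge (U.indicator φ x) ε with h | h
  · have hev : (fun x => max (U.indicator φ x - ε) 0 / sineProd b 0 x) =ᶠ[nhds x]
        fun _ => 0 := by
      filter_upwards [hφ.continuous_indicator.continuousAt.eventually_lt_const h] with y hy
      rw [max_eq_right (by linarith), zero_div]
    exact continuousAt_const.congr hev.symm
  · have hxU : x ∈ U := by
      by_contra hx
      rw [Set.indicator_of_notMem hx] at h
      linarith
    refine ContinuousAt.div ?_ (continuous_sineProd b 0).continuousAt
      (sineProd_zero_pos hb (hU hxU)).ne'
    exact ((hφ.continuous_indicator.sub continuous_const).max continuous_const).continuousAt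

theorem le_of_subset_box (hφ : IsPrincipalDirichletEigenfunction U φ) (hUo : IsOpen U)
    (hb : ∀ i, 0 < b i) (hU : U ⊆ box n b) {T : ℝ} (hT0 : 0 ≤ T) (hT : ∀ i, b i ^ 2 ≤ T)
    {x : EuclideanSpace ℝ (Fin n)} (hx : x ∈ U) :
    φ x ≤ exp ((dirichletEigenvalue n U - boxFreq b 0) * T) *
      (2 / √(∏ i, b i) * ((1 - 2 * exp (-1))⁻¹) ^ n) := by
  set lam := dirichletEigenvalue n U
  set q : ℝ := 2 * exp (-1) with hq
  have hq0 : 0 ≤ q := by positivity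
  have hq1 : q < 1 := by
    have := exp_one_gt_d9
    rw [hq, exp_neg, ← div_eq_mul_inv, div_lt_one (exp_pos 1)]
    linarith
  refine le_of_forall_small_pos (K := 2 * exp (lam * T)) (V := volume.real (box n b))
    fun ε hε hεV => ?_
  set h : EuclideanSpace ℝ (Fin n) → ℝ :=
    fun x => max (U.indicator φ x - ε) 0 / sineProd b 0 x with hh
  have hhc : Continuous h := hφ.continuousOn_truncation_div hb hU hε
  have hg : ∀ y, h y * sineProd b 0 y = max (U.indicator φ y - ε) 0 := by
    intro y
    by_cases hy : y ∈ U
    · exact div_mul_cancel₀ _ (sineProd_zero_pos hb (hU hy)).ne'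
    · have : max (U.indicator φ y - ε) 0 = 0 := by
        rw [Set.indicator_of_notMem hy]
        exact max_eq_right (by linarith)
      simp only [hh, this, zero_div, zero_mul]
  have hgsq : ∫ y in box n b, (h y * sineProd b 0 y) ^ 2 ≤ 1 := by
    have h1 : ∫ y in box n b, (h y * sineProd b 0 y) ^ 2 ≤
        ∫ y in box n b, (U.indicator φ y) ^ 2 := by
      refine setIntegral_mono_on
        (integrableOn_box ((hhc.mul (continuous_sineProd b 0)).pow 2).continuousOn)
        (integrableOn_box (hφ.continuous_indicator.pow 2).continuousOn)
        (isOpen_box b).measurableSet fun y _ => ?_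
      rw [hg]
      exact pow_le_pow_left₀ (le_max_right _ _)
        (max_le (by linarith) (hφ.indicator_nonneg y)) 2
    have h2 : ∀ y, (U.indicator φ y) ^ 2 = U.indicator (fun y => φ y ^ 2) y := fun y => by
      by_cases hy : y ∈ U <;> simp [hy]
    simp_rw [h2] at h1
    rw [setIntegral_indicator hUo.measurableSet, Set.inter_eq_self_of_subset_right hU,
      hφ.normalized] at h1
    exact h1
  obtain ⟨F, c, -, happ⟩ := exists_sineProd_approx hb hhc.continuousOn hε
  have hcoef : ∀ k ∈ F, |c k| ≤ 2 / √(∏ i, b i) := fun k hk =>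
    abs_coeff_le hb (hhc.mul (continuous_sineProd b 0)).continuousOn hgsq hεV happ hk
  set v : ℝ → EuclideanSpace ℝ (Fin n) → ℝ :=
    fun t x => ∑ k ∈ F, c k * (exp (-boxFreq b k * t) * sineProd b k x) with hv
  have hv0 : ∀ y, v 0 y = ∑ k ∈ F, c k * sineProd b k y := fun y => by simp [hv]
  have hvfr : ∀ t, ∀ y ∈ frontier (box n b), v t y = 0 := fun t y hy =>
    Finset.sum_eq_zero fun k _ => by rw [sineProd_frontier hb k hy]; ring
  have hvnn : ∀ t, 0 ≤ t → ∀ y ∈ closedBox b, -1 * v t y ≤ ε := by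
    intro t ht y hy
    by_cases hyb : y ∈ box n b
    · refine ((isHeatSolution_sineProd b (isOpen_box b) F c).const_mul (-1)).le_of_le_boundary
        (isOpen_box b) (isBounded_box b) (fun z hz => ?_) (fun s _ z hz => ?_) ht hyb
      · have h1 := abs_le.1 (happ z (box_subset_closedBox hz))
        rw [hg] at h1
        have h2 : -1 * v 0 z ≤ ε := by
          rw [hv0]
          linarith [h1.1, le_max_right (U.indicator φ z - ε) 0]
        exact h2
      · have h2 : -1 * v s z ≤ ε := by rw [hvfr s z hz]; linarith
        exact h2
    · have : y ∈ frontier (box n b) := by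
        rw [(isOpen_box b).frontier_eq]
        exact ⟨closedBox_subset_closure hb hy, hyb⟩
      rw [hvfr t y this]; linarith
  have hcl : closure U ⊆ closedBox b := (closure_mono hU).trans closure_box_subset
  have hmain : exp (-lam * T) * φ x + -1 * v T x ≤ 2 * ε := by
    refine ((hφ.isHeatSolution le_rfl).add hUo
      ((isHeatSolution_sineProd b hUo F c).const_mul (-1))).le_of_le_boundary
      hUo ((isBounded_box b).subset hU) (fun z hz => ?_) (fun s hs z hz => ?_) hT0 hx
    · have h1 := abs_le.1 (happ z (hcl (subset_closure hz)))
      rw [hg, Set.indicator_of_mem hz] at h1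
      have h2 : exp (-lam * 0) * φ z + -1 * v 0 z ≤ 2 * ε := by
        rw [hv0, mul_zero, exp_zero]
        linarith [h1.1, le_max_left (φ z - ε) 0]
      exact h2
    · have h2 : exp (-lam * s) * φ z + -1 * v s z ≤ 2 * ε := by
        rw [hφ.vanishes z hz]
        linarith [hvnn s hs z (hcl (frontier_subset_closure hz))]
      exact h2
  have hvT : v T x ≤ exp (-boxFreq b 0 * T) * (2 / √(∏ i, b i) * ((1 - q)⁻¹) ^ n) := by
    have hxb := hcl (subset_closure hx)
    have hs1 : sineProd b 0 x ≤ 1 := (le_abs_self _).trans (abs_sineProd_le_one b 0 x)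
    calc v T x ≤ ∑ k ∈ F, 2 / √(∏ i, b i) * (exp (-boxFreq b 0 * T) * ∏ i, q ^ k i) := by
          refine Finset.sum_le_sum fun k hk => (le_abs_self _).trans ?_
          rw [abs_mul, abs_mul, abs_of_pos (exp_pos _)]
          refine mul_le_mul (hcoef k hk) ?_ (by positivity) (by positivity)
          refine (exp_boxFreq_mul_abs_sineProd_le hb zero_le_one
            (fun i => by simpa using hT i) k hxb).trans ?_
          refine mul_le_mul_of_nonneg_right ?_ (Finset.prod_nonneg fun i _ => pow_nonneg hq0 _)
          exact mul_le_of_le_one_right (exp_pos _).le hs1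
      _ = 2 / √(∏ i, b i) * (exp (-boxFreq b 0 * T) * ∑ k ∈ F, ∏ i, q ^ k i) := by
          rw [← Finset.mul_sum, ← Finset.mul_sum]
      _ ≤ 2 / √(∏ i, b i) * (exp (-boxFreq b 0 * T) * ((1 - q)⁻¹) ^ n) := by
          gcongr
          exact sum_prod_pow_le hq0 hq1 F
      _ = _ := by ring
  have hfin : exp (-lam * T) * φ x ≤
      exp (-boxFreq b 0 * T) * (2 / √(∏ i, b i) * ((1 - q)⁻¹) ^ n) + 2 * ε := by linarith
  have hmul := mul_le_mul_of_nonneg_left hfin (exp_pos (lam * T)).le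
  have e1 : exp (lam * T) * (exp (-lam * T) * φ x) = φ x := by
    rw [← mul_assoc, ← exp_add]; simp
  have e2 : exp ((lam - boxFreq b 0) * T) = exp (lam * T) * exp (-boxFreq b 0 * T) := by
    rw [← exp_add]; congr 1; ring
  rw [e1] at hmul
  rw [e2]
  linarith

theorem ge_of_box_subset (hφ : IsPrincipalDirichletEigenfunction U φ) (hb : ∀ i, 0 < b i)
    (hU : box n b ⊆ U) {τ T : ℝ} (hτ : 0 ≤ τ) (hq1 : 2 * exp (-τ) < 1) (hT0 : 0 ≤ T)
    (hT : ∀ i, τ * b i ^ 2 ≤ T) {x : EuclideanSpace ℝ (Fin n)} (hx : x ∈ box n b) :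
    exp ((dirichletEigenvalue n U - boxFreq b 0) * T) * sineProd b 0 x *
      ((∫ y in box n b, φ y * sineProd b 0 y ^ 2) / (∏ i, b i) -
        2 / √(∏ i, b i) * (((1 - 2 * exp (-τ))⁻¹) ^ n - 1)) ≤ φ x := by
  set lam := dirichletEigenvalue n U
  set q : ℝ := 2 * exp (-τ) with hq
  have hq0 : 0 ≤ q := by positivity
  have hB : 0 < ∏ i, b i := Finset.prod_pos fun i _ => hb i
  set V := volume.real (box n b)
  have hV : 0 ≤ V := measureReal_nonneg
  have hs0 := sineProd_zero_pos hb hx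
  have hs1 : ∀ y, |sineProd b 0 y| ≤ 1 := abs_sineProd_le_one b 0
  have hcl : closedBox b ⊆ closure U := (closedBox_subset_closure hb).trans (closure_mono hU)
  have hφc : ContinuousOn φ (closedBox b) := hφ.continuousOn.mono hcl
  have hsc := continuous_sineProd b 0
  refine le_of_forall_small_pos (V := V) (K := exp (lam * T) +
    exp (lam * T) * (exp (-boxFreq b 0 * T) * sineProd b 0 x * (V / ∏ i, b i)))
    fun ε hε hεV => ?_
  have hgsq : ∫ y in box n b, (φ y * sineProd b 0 y) ^ 2 ≤ 1 := by
    refine le_trans ?_ (hφ.setIntegral_sq_le_one hU)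
    refine setIntegral_mono_on (integrableOn_box ((hφc.mul hsc.continuousOn).pow 2))
      (hφ.integrableOn_sq.mono_set hU) (isOpen_box b).measurableSet fun y _ => ?_
    rw [mul_pow]
    refine mul_le_of_le_one_right (sq_nonneg _) ?_
    rw [← sq_abs]
    exact pow_le_one₀ (abs_nonneg _) (hs1 y)
  obtain ⟨F, c, h0F, happ⟩ := exists_sineProd_approx hb hφc hε
  have hcoef : ∀ k ∈ F, |c k| ≤ 2 / √(∏ i, b i) := fun k hk =>
    abs_coeff_le hb (hφc.mul hsc.continuousOn) hgsq hεV happ hk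
  set v : ℝ → EuclideanSpace ℝ (Fin n) → ℝ :=
    fun t x => ∑ k ∈ F, c k * (exp (-boxFreq b k * t) * sineProd b k x) with hv
  have hv0 : ∀ y, v 0 y = ∑ k ∈ F, c k * sineProd b k y := fun y => by simp [hv]
  have hmain : v T x + -1 * (exp (-lam * T) * φ x) ≤ ε := by
    refine ((isHeatSolution_sineProd b (isOpen_box b) F c).add (isOpen_box b)
      ((hφ.isHeatSolution hU).const_mul (-1))).le_of_le_boundary
      (isOpen_box b) (isBounded_box b) (fun z hz => ?_) (fun s hs z hz => ?_) hT0 hx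
    · have h1 := abs_le.1 (happ z (box_subset_closedBox hz))
      have h3 : φ z * sineProd b 0 z ≤ φ z :=
        mul_le_of_le_one_right (hφ.pos z (hU hz)).le ((le_abs_self _).trans (hs1 z))
      have h2 : v 0 z + -1 * (exp (-lam * 0) * φ z) ≤ ε := by
        rw [hv0, mul_zero, exp_zero]
        linarith [h1.2]
      exact h2
    · have h3 : v s z = 0 :=
        Finset.sum_eq_zero fun k _ => by rw [sineProd_frontier hb k hz]; ring
      have h4 : 0 ≤ exp (-lam * s) * φ z := mul_nonneg (exp_pos _).le
        (hφ.nonneg_of_mem_closure (closure_mono hU (frontier_subset_closure hz)))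
      have h2 : v s z + -1 * (exp (-lam * s) * φ z) ≤ ε := by
        rw [h3]; linarith
      exact h2
  have hc0 : (∫ y in box n b, φ y * sineProd b 0 y ^ 2) / (∏ i, b i) - ε * (V / ∏ i, b i) ≤
      c 0 := by
    have h1 := setIntegral_sum_sineProd_mul hb F c h0F
    have hPc : Continuous fun x => ∑ k ∈ F, c k * sineProd b k x :=
      continuous_finsetSum _ fun k _ => continuous_const.mul (continuous_sineProd b k)
    have hi1 : IntegrableOn (fun y => φ y * sineProd b 0 y ^ 2) (box n b) :=
      integrableOn_box (hφc.mul (hsc.pow 2).continuousOn)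
    have hi2 : IntegrableOn (fun _ => ε) (box n b) :=
      integrableOn_box (b := b) continuousOn_const
    have h2 : ∫ y in box n b, (φ y * sineProd b 0 y ^ 2 - ε) ≤
        ∫ y in box n b, (∑ k ∈ F, c k * sineProd b k y) * sineProd b 0 y := by
      refine setIntegral_mono_on (hi1.sub hi2) (integrableOn_box (hPc.mul hsc).continuousOn)
        (isOpen_box b).measurableSet fun y hy => ?_
      have h3 := (abs_le.1 (happ y (box_subset_closedBox hy))).1
      have h4 := sineProd_zero_pos hb hy
      have h5 := (le_abs_self _).trans (hs1 y)
      nlinarith [mul_le_mul_of_nonneg_right h3 h4.le]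
    rw [integral_sub hi1 hi2, h1, setIntegral_const, smul_eq_mul] at h2
    rw [mul_div_assoc', ← sub_div, div_le_iff₀ hB]
    linarith
  have hvT : exp (-boxFreq b 0 * T) * sineProd b 0 x *
      (c 0 - 2 / √(∏ i, b i) * (((1 - q)⁻¹) ^ n - 1)) ≤ v T x := by
    have hsplit := Finset.add_sum_erase F
      (fun k => c k * (exp (-boxFreq b k * T) * sineProd b k x)) h0F
    have htail : -(2 / √(∏ i, b i) * (exp (-boxFreq b 0 * T) * sineProd b 0 x *
        (((1 - q)⁻¹) ^ n - 1))) ≤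
        ∑ k ∈ F.erase 0, c k * (exp (-boxFreq b k * T) * sineProd b k x) := by
      have hsum : ∑ k ∈ F.erase 0, ∏ i, q ^ k i ≤ ((1 - q)⁻¹) ^ n - 1 := by
        have h1 := Finset.add_sum_erase F (fun k => ∏ i, q ^ k i) h0F
        have h2 := sum_prod_pow_le hq0 hq1 F
        simp only [Pi.zero_apply, pow_zero, Finset.prod_const_one] at h1
        linarith
      calc _ ≤ -(2 / √(∏ i, b i) * (exp (-boxFreq b 0 * T) * sineProd b 0 x *
            ∑ k ∈ F.erase 0, ∏ i, q ^ k i)) := by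
            gcongr
        _ = ∑ k ∈ F.erase 0, -(2 / √(∏ i, b i) * (exp (-boxFreq b 0 * T) * sineProd b 0 x *
            ∏ i, q ^ k i)) := by
            rw [Finset.sum_neg_distrib, ← Finset.mul_sum, ← Finset.mul_sum]
        _ ≤ _ := by
            refine Finset.sum_le_sum fun k hk => neg_le_of_neg_le ?_
            refine (neg_le_abs _).trans ?_
            rw [abs_mul, abs_mul, abs_of_pos (exp_pos _)]
            exact mul_le_mul (hcoef k (Finset.mem_of_mem_erase hk))
              (exp_boxFreq_mul_abs_sineProd_le hb hτ hT k (box_subset_closedBox hx))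
              (by positivity) (by positivity)
    simp only [hv]
    rw [← hsplit]
    linarith
  have hE := exp_pos (-boxFreq b 0 * T)
  have hfin : exp (-boxFreq b 0 * T) * sineProd b 0 x *
      ((∫ y in box n b, φ y * sineProd b 0 y ^ 2) / (∏ i, b i) - ε * (V / ∏ i, b i) -
        2 / √(∏ i, b i) * (((1 - q)⁻¹) ^ n - 1)) ≤ exp (-lam * T) * φ x + ε := by
    have : exp (-boxFreq b 0 * T) * sineProd b 0 x *
      ((∫ y in box n b, φ y * sineProd b 0 y ^ 2) / (∏ i, b i) - ε * (V / ∏ i, b i) -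
        2 / √(∏ i, b i) * (((1 - q)⁻¹) ^ n - 1)) ≤ exp (-boxFreq b 0 * T) * sineProd b 0 x *
      (c 0 - 2 / √(∏ i, b i) * (((1 - q)⁻¹) ^ n - 1)) := by gcongr
    linarith
  have hmul := mul_le_mul_of_nonneg_left hfin (exp_pos (lam * T)).le
  have e1 : exp (lam * T) * (exp (-lam * T) * φ x) = φ x := by
    rw [← mul_assoc, ← exp_add]; simp
  have e2 : exp ((lam - boxFreq b 0) * T) = exp (lam * T) * exp (-boxFreq b 0 * T) := by
    rw [← exp_add]; congr 1; ring
  rw [mul_add, e1] at hmul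
  rw [e2]
  linarith

end IsPrincipalDirichletEigenfunction

open Filter Topology

lemma exists_exp_neg_small (n : ℕ) {ε : ℝ} (hε : 0 < ε) :
    ∃ τ : ℝ, 0 ≤ τ ∧ 2 * exp (-τ) < 1 ∧ 2 * (((1 - 2 * exp (-τ))⁻¹) ^ n - 1) ≤ ε := by
  have h0 : Tendsto (fun τ : ℝ => 2 * exp (-τ)) atTop (𝓝 0) := by
    simpa using tendsto_exp_neg_atTop_nhds_zero.const_mul 2
  have h1 : Tendsto (fun τ : ℝ => 2 * (((1 - 2 * exp (-τ))⁻¹) ^ n - 1)) atTop (𝓝 0) := by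
    have := ((((h0.const_sub 1).inv₀ (by norm_num)).pow n).sub_const 1).const_mul 2
    simpa using this
  obtain ⟨τ, h⟩ := ((eventually_ge_atTop 0).and
    ((h0.eventually_lt_const one_pos).and (h1.eventually_le_const hε))).exists
  exact ⟨τ, h⟩

lemma cos_pow_le_sineProd {n : ℕ} {a : Fin n → ℝ} (ha : ∀ i, 0 < a i) {ρ : ℝ} (hρ0 : 0 < ρ)
    (hρ1 : ρ < 1) {x : EuclideanSpace ℝ (Fin n)} (hx : x ∈ box n fun i => ρ * a i) :
    cos (π * ρ / 2) ^ n ≤ sineProd a 0 x := by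
  have hρ : π * ρ / 2 ≤ π / 2 := by nlinarith [pi_pos]
  have hc : 0 ≤ cos (π * ρ / 2) := cos_nonneg_of_mem_Icc
    ⟨by have := mul_pos pi_pos hρ0; linarith [pi_pos], hρ⟩
  rw [sineProd_zero_eq_cos ha]
  calc cos (π * ρ / 2) ^ n = ∏ _i : Fin n, cos (π * ρ / 2) := by simp
    _ ≤ _ := by
      refine Finset.prod_le_prod (fun _ _ => hc) fun i _ => ?_
      have hai := ha i
      rw [← cos_abs (π * x i / (2 * a i)), abs_div, abs_mul, abs_of_pos pi_pos,
        abs_of_pos (by positivity : 0 < 2 * a i)]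
      refine cos_le_cos_of_nonneg_of_le_pi (by positivity) (by linarith [pi_pos]) ?_
      rw [div_le_div_iff₀ (by positivity) two_pos]
      have : |x i| ≤ ρ * a i := (hx i).le
      nlinarith [mul_le_mul_of_nonneg_left this pi_pos.le]

lemma boxEigenfunction_eq {n : ℕ} {a : Fin n → ℝ} (ha : ∀ i, 0 < a i)
    (x : EuclideanSpace ℝ (Fin n)) :
    boxEigenfunction n a x = sineProd a 0 x / √(∏ i, a i) := by
  rw [boxEigenfunction, Finset.prod_mul_distrib, sineProd_zero_eq_cos ha,
    sqrt_prod _ fun i _ => (ha i).le, Finset.prod_div_distrib, Finset.prod_const_one]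
  ring

namespace IsPrincipalDirichletEigenfunction

variable {n : ℕ} {a b : Fin n → ℝ} {U : Set (EuclideanSpace ℝ (Fin n))}
  {φ : EuclideanSpace ℝ (Fin n) → ℝ}

lemma boxFreq_le (hφ : IsPrincipalDirichletEigenfunction U φ) (hUo : IsOpen U)
    (hUne : U.Nonempty) (hb : ∀ i, 0 < b i) (hU : U ⊆ box n b) :
    boxFreq b 0 ≤ dirichletEigenvalue n U := by
  obtain ⟨x, hx⟩ := hUne
  by_contra! h
  have h1 : Tendsto (fun T => exp ((dirichletEigenvalue n U - boxFreq b 0) * T) *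
      (2 / √(∏ i, b i) * ((1 - 2 * exp (-1))⁻¹) ^ n)) atTop (𝓝 0) := by
    have := (tendsto_exp_atBot.comp ((tendsto_const_mul_atBot_of_neg (sub_neg.2 h)).2
      tendsto_id)).mul_const (2 / √(∏ i, b i) * ((1 - 2 * exp (-1))⁻¹) ^ n)
    simpa using this
  refine (hφ.pos x hx).not_ge (ge_of_tendsto h1 ?_)
  filter_upwards [eventually_ge_atTop 0,
    eventually_all.2 fun i => eventually_ge_atTop (b i ^ 2)] with T hT0 hT
  exact hφ.le_of_subset_box hUo hb hU hT0 hT hx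

lemma continuousOn_closedBox (hφ : IsPrincipalDirichletEigenfunction U φ) (ha : ∀ i, 0 < a i)
    (hU : box n a ⊆ U) : ContinuousOn φ (closedBox a) :=
  hφ.continuousOn.mono ((closedBox_subset_closure ha).trans (closure_mono hU))

lemma setIntegral_mul_sineProd_sq_pos (hφ : IsPrincipalDirichletEigenfunction U φ)
    (ha : ∀ i, 0 < a i) (hU : box n a ⊆ U) :
    0 < ∫ y in box n a, φ y * sineProd a 0 y ^ 2 := by
  have hpos : ∀ y ∈ box n a, 0 < φ y * sineProd a 0 y ^ 2 := fun y hy =>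
    mul_pos (hφ.pos y (hU hy)) (pow_pos (sineProd_zero_pos ha hy) 2)
  rw [setIntegral_pos_iff_support_of_nonneg_ae]
  · have hsupp : box n a ⊆ Function.support fun y => φ y * sineProd a 0 y ^ 2 :=
      fun y hy => (hpos y hy).ne'
    rw [Set.inter_eq_self_of_subset_right hsupp]
    exact (isOpen_box a).measure_pos volume ⟨0, zero_mem_box ha⟩
  · exact (ae_restrict_iff' (isOpen_box a).measurableSet).2
      (Eventually.of_forall fun y hy => (hpos y hy).le)
  · exact integrableOn_box ((hφ.continuousOn_closedBox ha hU).mul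
      ((continuous_sineProd a 0).pow 2).continuousOn)

lemma le_boxFreq (hφ : IsPrincipalDirichletEigenfunction U φ) (ha : ∀ i, 0 < a i)
    (hU : box n a ⊆ U) : dirichletEigenvalue n U ≤ boxFreq a 0 := by
  by_contra! h
  have hA : 0 < ∏ i, a i := Finset.prod_pos fun i _ => ha i
  set c₀ := (∫ y in box n a, φ y * sineProd a 0 y ^ 2) / ∏ i, a i
  have hc₀ : 0 < c₀ := div_pos (hφ.setIntegral_mul_sineProd_sq_pos ha hU) hA
  obtain ⟨τ, hτ0, hτ1, hτ2⟩ := exists_exp_neg_small n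
    (show 0 < √(∏ i, a i) * (c₀ / 2) by positivity)
  have hs := sineProd_zero_pos ha (zero_mem_box ha)
  set d := c₀ - 2 / √(∏ i, a i) * (((1 - 2 * exp (-τ))⁻¹) ^ n - 1) with hd
  have hd0 : 0 < d := by
    have : 2 / √(∏ i, a i) * (((1 - 2 * exp (-τ))⁻¹) ^ n - 1) ≤ c₀ / 2 := by
      rw [div_mul_eq_mul_div, div_le_iff₀ (sqrt_pos.2 hA)]
      linarith
    linarith
  have h1 : Tendsto (fun T => exp ((dirichletEigenvalue n U - boxFreq a 0) * T) *
      sineProd a 0 0 * d) atTop atTop :=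
    ((tendsto_exp_atTop.comp ((tendsto_const_mul_atTop_of_pos (sub_pos.2 h)).2
      tendsto_id)).atTop_mul_const hs).atTop_mul_const hd0
  obtain ⟨T, hT0, hT, hT1⟩ := ((eventually_ge_atTop 0).and
    ((eventually_all.2 fun i => eventually_ge_atTop (τ * a i ^ 2)).and
      (h1.eventually_gt_atTop (φ 0)))).exists
  exact hT1.not_ge (hφ.ge_of_box_subset ha hU hτ0 hτ1 hT0 hT (zero_mem_box ha))

/-- If `φ` is bounded by `D / √|b|` on `U ⊆ box b` and the boxes `a`, `b` are close, then `φ` has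
a definite amount of mass near the centre of `box a`. -/
lemma sq_mul_sqrt_le_setIntegral (hφ : IsPrincipalDirichletEigenfunction U φ) (hUo : IsOpen U)
    (ha : ∀ i, 0 < a i) (hb : ∀ i, 0 < b i) (haU : box n a ⊆ U) (hUb : U ⊆ box n b)
    {D ρ : ℝ} (hD : 0 < D) (hφD : ∀ x ∈ U, φ x ≤ D / √(∏ i, b i)) (hρ0 : 0 < ρ) (hρ1 : ρ < 1)
    (hρ : D ^ 2 * 2 ^ n * (1 - ρ ^ (2 * n)) ≤ 1 / 2) (hab : ∀ i, ρ * b i ≤ a i) :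
    (cos (π * ρ / 2) ^ n) ^ 2 * (√(∏ i, b i) / (2 * D)) ≤
      ∫ y in box n a, φ y * sineProd a 0 y ^ 2 := by
  set K := box n fun i => ρ * a i with hK
  set κ := cos (π * ρ / 2) ^ n
  have hB : 0 < ∏ i, b i := Finset.prod_pos fun i _ => hb i
  have hsB : 0 < √(∏ i, b i) := sqrt_pos.2 hB
  have hρa : ∀ i, 0 < ρ * a i := fun i => mul_pos hρ0 (ha i)
  have hKa : K ⊆ box n a := fun x hx i => (hx i).trans_le (by nlinarith [ha i])
  have hKU := hKa.trans haU
  have hKm : MeasurableSet K := (isOpen_box _).measurableSet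
  have hfin : ∀ {c : Fin n → ℝ}, volume (box n c) ≠ ⊤ := fun {c} =>
    ((isBounded_box c).measure_lt_top).ne
  have hUfin : volume U ≠ ⊤ := measure_ne_top_of_subset hUb hfin
  have hvol : volume.real (U \ K) ≤ 2 ^ n * (1 - ρ ^ (2 * n)) * ∏ i, b i := by
    have h1 : volume.real (U \ K) ≤ volume.real (box n b \ K) :=
      measureReal_mono (Set.sdiff_subset_sdiff_left hUb)
        (measure_ne_top_of_subset Set.sdiff_subset hfin)
    rw [measureReal_sdiff (hKU.trans hUb) hKm hfin, volume_real_box hb,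
      volume_real_box hρa] at h1
    have h2 : ∏ i, (ρ * (ρ * b i)) ≤ ∏ i, (ρ * a i) :=
      Finset.prod_le_prod (fun i _ => by have := hb i; positivity)
        fun i _ => mul_le_mul_of_nonneg_left (hab i) hρ0.le
    simp only [Finset.prod_mul_distrib, Finset.prod_const, Finset.card_univ,
      Fintype.card_fin] at h1 h2 ⊢
    have h3 : (2 : ℝ) ^ n * (ρ ^ n * (ρ ^ n * ∏ i, b i)) ≤ 2 ^ n * (ρ ^ n * ∏ i, a i) := by gcongr
    have h4 : ρ ^ (2 * n) = ρ ^ n * ρ ^ n := by ring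
    rw [h4]
    linarith
  have hout : ∫ y in U \ K, φ y ^ 2 ≤ 1 / 2 := by
    have h1 : ∫ y in U \ K, φ y ^ 2 ≤ ∫ y in U \ K, (D / √(∏ i, b i)) ^ 2 := by
      refine setIntegral_mono_on (hφ.integrableOn_sq.mono_set Set.sdiff_subset)
        (integrableOn_const (measure_ne_top_of_subset Set.sdiff_subset hUfin))
        (hUo.measurableSet.diff hKm) fun y hy => ?_
      exact pow_le_pow_left₀ (hφ.pos y hy.1).le (hφD y hy.1) 2
    rw [setIntegral_const, smul_eq_mul, div_pow, sq_sqrt hB.le] at h1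
    refine h1.trans (le_trans (mul_le_mul_of_nonneg_right hvol (by positivity)) ?_)
    refine le_of_eq_of_le ?_ hρ
    field_simp
  have hin : 1 / 2 ≤ ∫ y in K, φ y ^ 2 := by
    have h1 := setIntegral_sdiff hKm hφ.integrableOn_sq hKU
    rw [hφ.normalized] at h1
    linarith
  have hφc := hφ.continuousOn_closedBox ha haU
  have hi : IntegrableOn (fun y => φ y * sineProd a 0 y ^ 2) (box n a) :=
    integrableOn_box (hφc.mul ((continuous_sineProd a 0).pow 2).continuousOn)
  have hκ : 0 ≤ κ := pow_nonneg (cos_nonneg_of_mem_Icc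
    ⟨by have := mul_pos pi_pos hρ0; linarith [pi_pos], by nlinarith [pi_pos]⟩) n
  calc κ ^ 2 * (√(∏ i, b i) / (2 * D))
      ≤ κ ^ 2 * (√(∏ i, b i) / D) * ∫ y in K, φ y ^ 2 := by
        have : κ ^ 2 * (√(∏ i, b i) / (2 * D)) = κ ^ 2 * (√(∏ i, b i) / D) * (1 / 2) := by
          field_simp
        rw [this]
        gcongr
    _ = ∫ y in K, κ ^ 2 * (√(∏ i, b i) / D) * φ y ^ 2 := (integral_const_mul _ _).symm
    _ ≤ ∫ y in K, φ y * sineProd a 0 y ^ 2 := by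
        refine setIntegral_mono_on ((hφ.integrableOn_sq.mono_set hKU).const_mul _)
          (hi.mono_set hKa) hKm fun y hy => ?_
        have hφy := hφ.pos y (hKU hy)
        have h1 : κ ^ 2 ≤ sineProd a 0 y ^ 2 :=
          pow_le_pow_left₀ hκ (cos_pow_le_sineProd ha hρ0 hρ1 hy) 2
        have h2 : √(∏ i, b i) / D * φ y ≤ 1 := by
          have := hφD y (hKU hy)
          rw [le_div_iff₀ hsB] at this
          rw [div_mul_eq_mul_div, div_le_one hD]
          linarith
        calc κ ^ 2 * (√(∏ i, b i) / D) * φ y ^ 2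
            = κ ^ 2 * φ y * (√(∏ i, b i) / D * φ y) := by ring
          _ ≤ κ ^ 2 * φ y * 1 := by gcongr
          _ ≤ φ y * sineProd a 0 y ^ 2 := by nlinarith
    _ ≤ _ := by
        refine setIntegral_mono_set hi ?_ hKa.eventuallyLE
        exact (ae_restrict_iff' (isOpen_box a).measurableSet).2 (Eventually.of_forall
          fun y hy => mul_nonneg (hφ.pos y (haU hy)).le (sq_nonneg _))

end IsPrincipalDirichletEigenfunction

lemma boxFreq_sub_le {n : ℕ} {a b : Fin n → ℝ} {M : ℝ}
    (h : ∀ i, 1 / a i ^ 2 - 1 / b i ^ 2 ≤ M) :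
    boxFreq a 0 - boxFreq b 0 ≤ π ^ 2 / 4 * n * M := by
  have : boxFreq a 0 - boxFreq b 0 = ∑ i, π ^ 2 / 4 * (1 / a i ^ 2 - 1 / b i ^ 2) := by
    simp only [boxFreq, ← Finset.sum_sub_distrib]
    refine Finset.sum_congr rfl fun i _ => ?_
    simp only [Pi.zero_apply, Nat.cast_zero, zero_add, one_mul, div_pow, mul_pow]
    ring
  rw [this]
  calc _ ≤ ∑ _i : Fin n, π ^ 2 / 4 * M :=
        Finset.sum_le_sum fun i _ => mul_le_mul_of_nonneg_left (h i) (by positivity)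
    _ = _ := by simp; ring

theorem stmt_10 (n : ℕ) (hn : 1 ≤ n) (C₁ : ℝ) (hC₁ : 0 < C₁) :
    ∃ δ > (1 : ℝ), ∃ c > (0 : ℝ), ∀ a b : Fin n → ℝ, (∀ i, 0 < a i) → (∀ i, 0 < b i) →
      box n a ⊆ box n b →
      (∀ i j, 1 / (a i) ^ 2 - 1 / (b i) ^ 2 ≤ C₁ / (b j) ^ 2) →
      (∀ i, b i / δ ≤ a i) →
      ∀ U : Set (EuclideanSpace ℝ (Fin n)), IsOpen U → IsConnected U →
        box n a ⊆ U → U ⊆ box n b →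
        ∀ φ : EuclideanSpace ℝ (Fin n) → ℝ, IsPrincipalDirichletEigenfunction U φ →
          ∀ x ∈ box n a, c * boxEigenfunction n a x ≤ φ x := by
  have he : 0 < 1 - 2 * exp (-1) := by
    have h1 := exp_one_gt_d9
    have h2 : 2 * exp (-1) < 1 := by
      rw [exp_neg, ← div_eq_mul_inv, div_lt_one (exp_pos 1)]
      linarith
    linarith
  set G : ℝ := π ^ 2 / 4 * n * C₁ with hG
  have hG0 : 0 ≤ G := by positivity
  set D : ℝ := exp G * (2 * ((1 - 2 * exp (-1))⁻¹) ^ n) with hD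
  have hD0 : 0 < D := by positivity
  obtain ⟨ρ, hρ, hρ0, hρ1⟩ : ∃ ρ : ℝ, D ^ 2 * 2 ^ n * (1 - ρ ^ (2 * n)) ≤ 1 / 2 ∧ 0 < ρ ∧
      ρ < 1 := by
    have h1 : Tendsto (fun ρ : ℝ => D ^ 2 * 2 ^ n * (1 - ρ ^ (2 * n))) (𝓝[<] 1) (𝓝 0) := by
      have : Continuous fun ρ : ℝ => D ^ 2 * 2 ^ n * (1 - ρ ^ (2 * n)) := by fun_prop
      have h2 := (this.tendsto 1).mono_left (nhdsWithin_le_nhds (s := Set.Iio 1))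
      simpa using h2
    have h3 : ∀ᶠ ρ : ℝ in 𝓝[<] 1, 0 < ρ ∧ ρ < 1 := Ioo_mem_nhdsLT one_pos
    exact ((h1.eventually_le_const one_half_pos).and h3).exists
  set κ := cos (π * ρ / 2) ^ n with hκ
  have hκ0 : 0 < κ := pow_pos (cos_pos_of_mem_Ioo
    ⟨by have := mul_pos pi_pos hρ0; linarith [pi_pos], by nlinarith [pi_pos]⟩) n
  set c₁ := κ ^ 2 / (2 * D) with hc₁
  have hc₁0 : 0 < c₁ := by positivity
  obtain ⟨τ, hτ0, hτ1, hτ2⟩ := exists_exp_neg_small n (half_pos hc₁0)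
  refine ⟨1 / ρ, (one_lt_div hρ0).2 hρ1, exp (-(G * τ)) * (c₁ / 2), by positivity, ?_⟩
  intro a b ha hb hsub hfreq hδ U hUo hUc haU hUb φ hφ x hx
  obtain ⟨j, -, hj⟩ := Finset.exists_max_image Finset.univ b ⟨⟨0, hn⟩, Finset.mem_univ _⟩
  have hL := hb j
  have hba : ∀ i, a i ≤ b i := le_of_box_subset ha hsub
  have hbj : ∀ i, b i ^ 2 ≤ b j ^ 2 := fun i =>
    pow_le_pow_left₀ (hb i).le (hj i (Finset.mem_univ _)) 2
  have hA : 0 < ∏ i, a i := Finset.prod_pos fun i _ => ha i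
  have hAB : ∏ i, a i ≤ ∏ i, b i := Finset.prod_le_prod (fun i _ => (ha i).le) fun i _ => hba i
  have hsA : 0 < √(∏ i, a i) := sqrt_pos.2 hA
  set lam := dirichletEigenvalue n U with hlam
  have hlb : boxFreq b 0 ≤ lam := hφ.boxFreq_le hUo hUc.nonempty hb hUb
  have hla : lam ≤ boxFreq a 0 := hφ.le_boxFreq ha haU
  have hgap : (boxFreq a 0 - boxFreq b 0) * b j ^ 2 ≤ G := by
    have h1 := boxFreq_sub_le fun i => hfreq i j
    rw [mul_div_assoc', le_div_iff₀ (by positivity)] at h1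
    exact h1
  have hφD : ∀ y ∈ U, φ y ≤ D / √(∏ i, b i) := fun y hy => by
    refine (hφ.le_of_subset_box hUo hb hUb (sq_nonneg (b j)) hbj hy).trans ?_
    have h1 : exp ((lam - boxFreq b 0) * b j ^ 2) ≤ exp G := by
      refine exp_le_exp.2 (le_trans ?_ hgap)
      gcongr
    calc _ ≤ exp G * (2 / √(∏ i, b i) * ((1 - 2 * exp (-1))⁻¹) ^ n) := by gcongr
      _ = _ := by rw [hD]; ring
  have hmass := hφ.sq_mul_sqrt_le_setIntegral hUo ha hb haU hUb hD0 hφD hρ0 hρ1 hρ fun i => by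
    have := hδ i
    rwa [div_div_eq_mul_div, div_one, mul_comm] at this
  have hmean : c₁ / √(∏ i, a i) ≤
      (∫ y in box n a, φ y * sineProd a 0 y ^ 2) / ∏ i, a i := by
    rw [le_div_iff₀ hA]
    refine le_trans ?_ hmass
    have h1 : c₁ / √(∏ i, a i) * ∏ i, a i = c₁ * √(∏ i, a i) := by
      rw [div_mul_eq_mul_div, mul_div_assoc, div_sqrt]
    have h2 : κ ^ 2 * (√(∏ i, b i) / (2 * D)) = c₁ * √(∏ i, b i) := by rw [hc₁]; ring
    rw [h1, ← hκ, h2]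
    exact mul_le_mul_of_nonneg_left (sqrt_le_sqrt hAB) hc₁0.le
  refine le_trans ?_ (hφ.ge_of_box_subset ha haU hτ0 hτ1 (T := τ * b j ^ 2) (by positivity)
    (fun i => mul_le_mul_of_nonneg_left
      ((pow_le_pow_left₀ (ha i).le (hba i) 2).trans (hbj i)) hτ0) hx)
  have hs := sineProd_zero_pos ha hx
  have hexp : exp (-(G * τ)) ≤ exp ((lam - boxFreq a 0) * (τ * b j ^ 2)) := by
    refine exp_le_exp.2 ?_
    have h1 : (boxFreq a 0 - lam) * b j ^ 2 ≤ G := by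
      refine le_trans ?_ hgap
      gcongr
    nlinarith [mul_le_mul_of_nonneg_right h1 hτ0]
  have hcoef : c₁ / 2 / √(∏ i, a i) ≤
      (∫ y in box n a, φ y * sineProd a 0 y ^ 2) / (∏ i, a i) -
        2 / √(∏ i, a i) * (((1 - 2 * exp (-τ))⁻¹) ^ n - 1) := by
    have h1 : 2 / √(∏ i, a i) * (((1 - 2 * exp (-τ))⁻¹) ^ n - 1) ≤ c₁ / 2 / √(∏ i, a i) := by
      rw [div_mul_eq_mul_div]
      gcongr
    have h2 : c₁ / √(∏ i, a i) = c₁ / 2 / √(∏ i, a i) + c₁ / 2 / √(∏ i, a i) := by ring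
    linarith
  calc exp (-(G * τ)) * (c₁ / 2) * boxEigenfunction n a x
      = exp (-(G * τ)) * sineProd a 0 x * (c₁ / 2 / √(∏ i, a i)) := by
        rw [boxEigenfunction_eq ha]; ring
    _ ≤ _ := by
        refine mul_le_mul (mul_le_mul_of_nonneg_right hexp hs.le) hcoef (by positivity) ?_
        positivity
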